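/- arXiv:2110.04927 — 6 statements merged into one kernel-verified Lean document; each statement's English description precedes it below -/
import Mathlib

section
/- Let a > y > b > c > d be real numbers. Set k² := ((a−b)(c−d)) / ((a−c)(b−d)), g := 2/√((a−c)(b−d)), and y₀ := √( ((a−c)(y−b)) / ((a−b)(y−c)) ). Then 0 < k² < 1, y₀ < 1, and ∫_{b}^{y} dλ / √( −(λ−a)(λ−b)(λ−c)(λ−d) ) = g · ∫_{0}^{y₀} dλ₀ / √( (1−λ₀²)(1−k²λ₀²) ), where the left-hand side is the (improper) integral over the interval (b, y]. -/
open scoped ENNReal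

/-- The rational substitution `t ↦ λ` inverse to `λ ↦ √((a - c)(λ - b) / ((a - b)(λ - c)))`. -/
noncomputable def ellipticSubst (a b c t : ℝ) : ℝ :=
  (b * (a - c) - c * (a - b) * t ^ 2) / ((a - c) - (a - b) * t ^ 2)

lemma ellipticSubst_denom_pos {a b c t : ℝ} (hba : b < a) (hcb : c < b) (ht : t ^ 2 < 1) :
    0 < (a - c) - (a - b) * t ^ 2 := by
  nlinarith [mul_pos (sub_pos.2 hba) (sub_pos.2 ht)]

lemma hasDerivAt_ellipticSubst {a b c t : ℝ} (hD : (a - c) - (a - b) * t ^ 2 ≠ 0) :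
    HasDerivAt (ellipticSubst a b c)
      (2 * t * ((a - b) * (b - c) * (a - c)) / ((a - c) - (a - b) * t ^ 2) ^ 2) t := by
  have hsq : HasDerivAt (fun t : ℝ => t ^ 2) (2 * t) t := by simpa using hasDerivAt_pow 2 t
  refine (((hsq.const_mul (c * (a - b))).const_sub (b * (a - c))).div
    ((hsq.const_mul (a - b)).const_sub (a - c)) hD).congr_deriv ?_
  congr 1
  ring

lemma ellipticSubst_injOn {a b c : ℝ} (hba : b < a) (hcb : c < b) :
    Set.InjOn (ellipticSubst a b c) (Set.Ioo 0 1) := by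
  intro s hs t ht h
  have hDs := ellipticSubst_denom_pos hba hcb (by nlinarith [hs.1, hs.2] : s ^ 2 < 1)
  have hDt := ellipticSubst_denom_pos hba hcb (by nlinarith [ht.1, ht.2] : t ^ 2 < 1)
  rw [ellipticSubst, ellipticSubst, div_eq_div_iff hDs.ne' hDt.ne'] at h
  have hK : (a - b) * (b - c) * (a - c) ≠ 0 :=
    (mul_pos (mul_pos (by linarith) (by linarith)) (by linarith)).ne'
  have hst : s ^ 2 = t ^ 2 := mul_left_cancel₀ hK (by linear_combination h)
  exact (pow_left_inj₀ hs.1.le ht.1.le two_ne_zero).1 hst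

lemma sqrt_cross_ratio_lt_one {a b c y : ℝ} (hya : y < a) (hby : b < y) (hcb : c < b) :
    √(((a - c) * (y - b)) / ((a - b) * (y - c))) < 1 := by
  rw [Real.sqrt_lt' one_pos, one_pow,
    div_lt_one (mul_pos (by linarith) (by linarith))]
  nlinarith [mul_pos (sub_pos.2 hya) (sub_pos.2 hcb)]

lemma ellipticSubst_image_Ioc {a b c y : ℝ} (hya : y < a) (hby : b < y) (hcb : c < b) :
    ellipticSubst a b c '' Set.Ioc 0 √(((a - c) * (y - b)) / ((a - b) * (y - c))) =
      Set.Ioc b y := by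
  have hab : 0 < a - b := by linarith
  have hac : 0 < a - c := by linarith
  have hbc : 0 < b - c := by linarith
  have hyc : 0 < y - c := by linarith
  ext l
  constructor
  · rintro ⟨t, ⟨ht0, ht⟩, rfl⟩
    have ht1 : t < 1 := ht.trans_lt (sqrt_cross_ratio_lt_one hya hby hcb)
    have hD := ellipticSubst_denom_pos (sub_pos.1 hab) hcb (by nlinarith : t ^ 2 < 1)
    rw [Real.le_sqrt' ht0, le_div_iff₀ (mul_pos hab hyc)] at ht
    rw [ellipticSubst, Set.mem_Ioc, lt_div_iff₀ hD, div_le_iff₀ hD]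
    constructor
    · nlinarith [mul_pos (mul_pos hab hbc) (pow_pos ht0 2)]
    · linarith
  · rintro ⟨hbl, hly⟩
    have hlc : 0 < l - c := by linarith
    have hlb : 0 < l - b := by linarith
    have hpos : 0 < ((a - c) * (l - b)) / ((a - b) * (l - c)) := by positivity
    refine ⟨√(((a - c) * (l - b)) / ((a - b) * (l - c))), ⟨Real.sqrt_pos.2 hpos, ?_⟩, ?_⟩
    · apply Real.sqrt_le_sqrt
      rw [div_le_div_iff₀ (mul_pos hab hlc) (mul_pos hab hyc)]
      have := mul_nonneg (mul_pos (mul_pos hac hab) hbc).le (sub_nonneg.2 hly)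
      linarith
    · have hD := ellipticSubst_denom_pos (t := √(((a - c) * (l - b)) / ((a - b) * (l - c))))
        (sub_pos.1 hab) hcb (by
          have := sqrt_cross_ratio_lt_one (hly.trans_lt hya) hbl hcb
          nlinarith [Real.sqrt_nonneg (((a - c) * (l - b)) / ((a - b) * (l - c)))])
      rw [ellipticSubst, div_eq_iff hD.ne', Real.sq_sqrt hpos.le]
      field_simp
      ring

lemma quartic_ellipticSubst {a b c d t : ℝ} (hac : a - c ≠ 0) (hbd : b - d ≠ 0)
    (hD : (a - c) - (a - b) * t ^ 2 ≠ 0) :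
    -((ellipticSubst a b c t - a) * (ellipticSubst a b c t - b) *
        (ellipticSubst a b c t - c) * (ellipticSubst a b c t - d)) =
      (t * ((a - b) * (b - c) * (a - c)) / ((a - c) - (a - b) * t ^ 2) ^ 2) ^ 2 *
        (((a - c) * (b - d)) *
          ((1 - t ^ 2) * (1 - (((a - b) * (c - d)) / ((a - c) * (b - d))) * t ^ 2))) := by
  have ha : ellipticSubst a b c t - a =
      -((a - b) * (a - c) * (1 - t ^ 2)) / ((a - c) - (a - b) * t ^ 2) := by
    rw [ellipticSubst, div_sub' hD]
    congr 1
    ring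
  have hb : ellipticSubst a b c t - b =
      (a - b) * (b - c) * t ^ 2 / ((a - c) - (a - b) * t ^ 2) := by
    rw [ellipticSubst, div_sub' hD]
    congr 1
    ring
  have hc : ellipticSubst a b c t - c =
      (b - c) * (a - c) / ((a - c) - (a - b) * t ^ 2) := by
    rw [ellipticSubst, div_sub' hD]
    congr 1
    ring
  have hd : ellipticSubst a b c t - d =
      ((a - c) * (b - d) - (a - b) * (c - d) * t ^ 2) / ((a - c) - (a - b) * t ^ 2) := by
    rw [ellipticSubst, div_sub' hD]
    congr 1
    ring
  have hk : 1 - (((a - b) * (c - d)) / ((a - c) * (b - d))) * t ^ 2 =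
      ((a - c) * (b - d) - (a - b) * (c - d) * t ^ 2) / ((a - c) * (b - d)) := by
    field_simp
  rw [ha, hb, hc, hd, hk]
  generalize (a - c) - (a - b) * t ^ 2 = D at hD
  generalize (a - c) * (b - d) - (a - b) * (c - d) * t ^ 2 = N
  field_simp

lemma deriv_mul_inv_sqrt_quartic_ellipticSubst {a b c d t : ℝ} (hba : b < a) (hcb : c < b)
    (hdc : d < c) (ht0 : 0 < t) (ht1 : t < 1) :
    2 * t * ((a - b) * (b - c) * (a - c)) / ((a - c) - (a - b) * t ^ 2) ^ 2 *
      (1 / √(-((ellipticSubst a b c t - a) * (ellipticSubst a b c t - b) *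
        (ellipticSubst a b c t - c) * (ellipticSubst a b c t - d)))) =
      2 / √((a - c) * (b - d)) *
        (1 / √((1 - t ^ 2) * (1 - (((a - b) * (c - d)) / ((a - c) * (b - d))) * t ^ 2))) := by
  have hab : 0 < a - b := by linarith
  have hac : 0 < a - c := by linarith
  have hbc : 0 < b - c := by linarith
  have hbd : 0 < b - d := by linarith
  have hD := ellipticSubst_denom_pos hba hcb (by nlinarith : t ^ 2 < 1)
  rw [quartic_ellipticSubst hac.ne' hbd.ne' hD.ne', Real.sqrt_mul (sq_nonneg _),
    Real.sqrt_sq (by positivity), Real.sqrt_mul (by positivity)]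
  have hE : t * ((a - b) * (b - c) * (a - c)) / ((a - c) - (a - b) * t ^ 2) ^ 2 ≠ 0 := by
    positivity
  rw [show 2 * t * ((a - b) * (b - c) * (a - c)) / ((a - c) - (a - b) * t ^ 2) ^ 2 =
    2 * (t * ((a - b) * (b - c) * (a - c)) / ((a - c) - (a - b) * t ^ 2) ^ 2) by ring]
  generalize t * ((a - b) * (b - c) * (a - c)) / ((a - c) - (a - b) * t ^ 2) ^ 2 = E at hE
  rw [div_mul_div_comm, mul_one, mul_one_div, mul_comm 2 E, mul_div_mul_left _ _ hE]

theorem stmt13 (a y b c d : ℝ) (hya : y < a) (hby : b < y) (hcb : c < b) (hdc : d < c) :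
    0 < ((a - b) * (c - d)) / ((a - c) * (b - d)) ∧
    ((a - b) * (c - d)) / ((a - c) * (b - d)) < 1 ∧
    Real.sqrt (((a - c) * (y - b)) / ((a - b) * (y - c))) < 1 ∧
    (∫⁻ lam in Set.Ioc b y,
        ENNReal.ofReal (1 / Real.sqrt (-((lam - a) * (lam - b) * (lam - c) * (lam - d)))))
      = ENNReal.ofReal (2 / Real.sqrt ((a - c) * (b - d))) *
        ∫⁻ t in Set.Ioc (0 : ℝ) (Real.sqrt (((a - c) * (y - b)) / ((a - b) * (y - c)))),
          ENNReal.ofReal (1 / Real.sqrt ((1 - t ^ 2) *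
            (1 - (((a - b) * (c - d)) / ((a - c) * (b - d))) * t ^ 2))) := by
  have hba : b < a := hby.trans hya
  have hab : 0 < a - b := by linarith
  have hac : 0 < a - c := by linarith
  have hbc : 0 < b - c := by linarith
  have hcd : 0 < c - d := by linarith
  have hbd : 0 < b - d := by linarith
  have hy := sqrt_cross_ratio_lt_one hya hby hcb
  refine ⟨by positivity, ?_, hy, ?_⟩
  · rw [div_lt_one (by positivity)]
    nlinarith [mul_pos hbc (by linarith : 0 < a - d)]
  have hD : ∀ t ∈ Set.Ioc 0 √(((a - c) * (y - b)) / ((a - b) * (y - c))),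
      0 < (a - c) - (a - b) * t ^ 2 := fun t ht =>
    ellipticSubst_denom_pos hba hcb (by nlinarith [ht.1, ht.2])
  have hinj : Set.InjOn (ellipticSubst a b c)
      (Set.Ioc 0 √(((a - c) * (y - b)) / ((a - b) * (y - c)))) :=
    (ellipticSubst_injOn hba hcb).mono (Set.Ioc_subset_Ioo_right hy)
  rw [← ellipticSubst_image_Ioc hya hby hcb,
    MeasureTheory.lintegral_image_eq_lintegral_abs_deriv_mul measurableSet_Ioc
      (fun t ht => (hasDerivAt_ellipticSubst (hD t ht).ne').hasDerivWithinAt) hinj,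
    ← MeasureTheory.lintegral_const_mul' _ _ ENNReal.ofReal_ne_top]
  refine MeasureTheory.setLIntegral_congr_fun measurableSet_Ioc fun t ht => ?_
  have ht0 := ht.1
  have hDt := hD t ht
  rw [abs_of_nonneg (by positivity), ← ENNReal.ofReal_mul (by positivity),
    ← ENNReal.ofReal_mul (by positivity),
    deriv_mul_inv_sqrt_quartic_ellipticSubst hba hcb hdc ht0 (ht.2.trans_lt hy)]
end

section
/- There exists a positive absolute constant C₁ such that for all real numbers a > b > c > d: ∫_{(d,c) ∪ (b,a)} dλ / √( −(λ−a)(λ−b)(λ−c)(λ−d) ) ≤ C₁ · g · ( 1 − log√(1 − k²) ), where k² := ((a−b)(c−d)) / ((a−c)(b−d)) ∈ (0,1) and g := 2/√((a−c)(b−d)). -/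
open scoped ENNReal

open MeasureTheory Set

/-- The fundamental theorem of calculus for a nonnegative derivative, as a lower Lebesgue
integral. -/
theorem setLIntegral_Ioo_deriv_eq {F f : ℝ → ℝ} {u v : ℝ} (huv : u ≤ v)
    (hF : ContinuousOn F (Icc u v)) (hd : ∀ x ∈ Ioo u v, HasDerivAt F (f x) x)
    (hf : ∀ x ∈ Ioo u v, 0 ≤ f x) :
    ∫⁻ x in Ioo u v, ENNReal.ofReal (f x) = ENNReal.ofReal (F v - F u) := by
  have hint : IntegrableOn f (Ioc u v) :=
    intervalIntegral.integrableOn_deriv_of_nonneg hF hd hf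
  have hint' : IntegrableOn f (Ioo u v) := hint.mono_set Ioo_subset_Ioc_self
  rw [← ofReal_integral_eq_lintegral_ofReal hint'
      ((ae_restrict_iff' measurableSet_Ioo).2 (Filter.Eventually.of_forall hf)),
    ← integral_Ioc_eq_integral_Ioo, ← intervalIntegral.integral_of_le huv,
    intervalIntegral.integral_eq_sub_of_hasDerivAt_of_le huv hF hd
      ((intervalIntegrable_iff_integrableOn_Ioc_of_le huv).2 hint)]

theorem one_div_sqrt_le_mul_div_sqrt {P Q k v : ℝ} (hP : 0 < P) (hQ : 0 < Q) (hk : 0 ≤ k)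
    (hv : 0 ≤ v) (h : Q ≤ k ^ 2 * v ^ 2 * P) : 1 / √P ≤ k * (v / √Q) := by
  rw [← mul_div_assoc, div_le_div_iff₀ (Real.sqrt_pos.2 hP) (Real.sqrt_pos.2 hQ), one_mul]
  refine Real.sqrt_le_iff.2 ⟨by positivity, ?_⟩
  rw [mul_pow, mul_pow, Real.sq_sqrt hP.le]
  exact h

theorem arsinh_sqrt_le {u R : ℝ} (hu : 0 ≤ u) (hR : 1 + u ≤ 2 * R) :
    Real.arsinh √u ≤ 2 + Real.log R / 2 := by
  have hR0 : 0 < R := by linarith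
  have h1 : √u ≤ √(2 * R) := Real.sqrt_le_sqrt (by linarith)
  have h2 : √(1 + √u ^ 2) ≤ √(2 * R) := by
    rw [Real.sq_sqrt hu]
    exact Real.sqrt_le_sqrt hR
  have h3 : √(2 * R) + √(2 * R) = √(8 * R) := by
    rw [show 8 * R = 2 ^ 2 * (2 * R) by ring, Real.sqrt_mul (by positivity) (2 * R),
      Real.sqrt_sq (by norm_num)]
    ring
  have h4 : Real.arsinh √u ≤ Real.log √(8 * R) := by
    unfold Real.arsinh
    exact Real.log_le_log (by positivity) (by linarith)
  have h5 : Real.log 8 = 3 * Real.log 2 := by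
    rw [show (8 : ℝ) = 2 ^ 3 by norm_num, Real.log_pow]
    norm_num
  rw [Real.log_sqrt (by positivity), Real.log_mul (by norm_num) hR0.ne', h5] at h4
  have := Real.log_two_lt_d9
  linarith

theorem setLIntegral_div_sqrt_sub {p k : ℝ} (hp : 0 < p) (hk : 0 ≤ k) :
    ∫⁻ x in Ioo 0 p, ENNReal.ofReal (k * (1 / √(p - x))) = ENNReal.ofReal (2 * k * √p) := by
  rw [setLIntegral_Ioo_deriv_eq (F := fun x => -2 * k * √(p - x)) hp.le (by fun_prop)]
  · congr 1
    simp
  · intro x hx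
    have hpx : 0 < p - x := sub_pos.2 hx.2
    have := ((((hasDerivAt_id' x).const_sub p).sqrt hpx.ne').const_mul (-2 * k))
    refine this.congr_deriv ?_
    field_simp
  · intro x hx
    positivity

theorem setLIntegral_div_sqrt {p k : ℝ} (hp : 0 < p) (hk : 0 ≤ k) :
    ∫⁻ x in Ioo 0 p, ENNReal.ofReal (k * (1 / √x)) = ENNReal.ofReal (2 * k * √p) := by
  rw [setLIntegral_Ioo_deriv_eq (F := fun x => 2 * k * √x) hp.le (by fun_prop)]
  · congr 1
    simp
  · intro x hx
    have := ((hasDerivAt_id' x).sqrt hx.1.ne').const_mul (2 * k)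
    refine this.congr_deriv ?_
    field_simp
  · intro x hx
    have := hx.1
    positivity

theorem one_div_sqrt_cubic_le {q s x : ℝ} (hq : 0 < q) (hqs : q < s) (hx : 0 < x) :
    1 / √(x * (x + q) * (x + s)) ≤
      4 / √s * (s ^ 2 / (q * (x + s) ^ 2) /
          (2 * √(x * s / (q * (x + s)) * (1 + x * s / (q * (x + s))))) +
        s / (x + s) ^ 2 / (2 * √(s / (x + s)))) := by
  have hs : 0 < s := hq.trans hqs
  have hss : (2 / √s) ^ 2 = 4 / s := by
    rw [div_pow, Real.sq_sqrt hs.le]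
    norm_num
  have key (A B S T : ℝ) : 4 / √s * (A / (2 * S) + B / (2 * T)) =
      2 / √s * (A / S) + 2 / √s * (B / T) := by
    rw [← div_div, ← div_div, div_right_comm A, div_right_comm B]
    ring
  rw [key]
  rcases le_or_gt x s with hxs | hxs
  · refine le_trans (one_div_sqrt_le_mul_div_sqrt (k := 2 / √s)
      (v := s ^ 2 / (q * (x + s) ^ 2))
      (Q := x * s / (q * (x + s)) * (1 + x * s / (q * (x + s))))
      (by positivity) (by positivity) (by positivity) (by positivity) ?_)
      (le_add_of_nonneg_right (by positivity))
    rw [hss]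
    have e1 : x * s / (q * (x + s)) * (1 + x * s / (q * (x + s))) =
        x * s * (q * x + q * s + x * s) * (x + s) / (q ^ 2 * (x + s) ^ 3) := by
      field_simp
    have e2 : 4 / s * (s ^ 2 / (q * (x + s) ^ 2)) ^ 2 * (x * (x + q) * (x + s)) =
        x * s * (2 * s * (q + x)) * (2 * s) / (q ^ 2 * (x + s) ^ 3) := by
      field_simp
      ring
    rw [e1, e2]
    have h1 : q * x + q * s + x * s ≤ 2 * s * (q + x) := by nlinarith
    have h2 : x + s ≤ 2 * s := by linarith
    gcongr
  · refine le_trans (one_div_sqrt_le_mul_div_sqrt (k := 2 / √s) (v := s / (x + s) ^ 2)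
      (Q := s / (x + s))
      (by positivity) (by positivity) (by positivity) (by positivity) ?_)
      (le_add_of_nonneg_left (by positivity))
    rw [hss]
    have e1 : s / (x + s) = s * ((x + s) * (x + s)) / (x + s) ^ 3 := by
      field_simp
    have e2 : 4 / s * (s / (x + s) ^ 2) ^ 2 * (x * (x + q) * (x + s)) =
        s * ((2 * x) * (2 * (x + q))) / (x + s) ^ 3 := by
      field_simp
      ring
    rw [e1, e2]
    have h1 : x + s ≤ 2 * x := by linarith
    have h2 : x + s ≤ 2 * (x + q) := by linarith
    gcongr

theorem setLIntegral_cubic_le {p q s k : ℝ} (hp : 0 < p) (hq : 0 < q) (hqs : q < s)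
    (hk : 0 ≤ k) :
    ∫⁻ x in Ioo 0 p, ENNReal.ofReal (k * (1 / √(x * (x + q) * (x + s)))) ≤
      ENNReal.ofReal (k * (4 / √s) * (Real.arsinh √(p * s / (q * (p + s))) + 1)) := by
  have hs : 0 < s := hq.trans hqs
  set F : ℝ → ℝ := fun x =>
    k * (4 / √s) * (Real.arsinh √(x * s / (q * (x + s))) - √(s / (x + s))) with hF
  set f : ℝ → ℝ := fun x => k * (4 / √s) * (s ^ 2 / (q * (x + s) ^ 2) /
          (2 * √(x * s / (q * (x + s)) * (1 + x * s / (q * (x + s))))) +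
        s / (x + s) ^ 2 / (2 * √(s / (x + s)))) with hf
  calc _ ≤ ∫⁻ x in Ioo 0 p, ENNReal.ofReal (f x) := by
        refine setLIntegral_mono' measurableSet_Ioo fun x hx => ENNReal.ofReal_le_ofReal ?_
        simp only [hf, mul_assoc k]
        exact mul_le_mul_of_nonneg_left (one_div_sqrt_cubic_le hq hqs hx.1) hk
    _ = ENNReal.ofReal (F p - F 0) := by
        refine setLIntegral_Ioo_deriv_eq hp.le ?_ ?_ ?_
        · have h1 : ∀ x ∈ Icc 0 p, q * (x + s) ≠ 0 := fun x hx => by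
            have := hx.1
            positivity
          have h2 : ∀ x ∈ Icc 0 p, x + s ≠ 0 := fun x hx => by
            have := hx.1
            positivity
          refine continuousOn_const.mul (ContinuousOn.sub ?_ ?_)
          · exact Real.continuous_arsinh.comp_continuousOn
              (ContinuousOn.sqrt (ContinuousOn.div (by fun_prop) (by fun_prop) h1))
          · exact ContinuousOn.sqrt (ContinuousOn.div (by fun_prop) (by fun_prop) h2)
        · intro x hx
          have hx0 := hx.1
          have hu : 0 < x * s / (q * (x + s)) := by positivity
          have hw : 0 < s / (x + s) := by positivity
          have d1 : HasDerivAt (fun x => x * s / (q * (x + s))) (s ^ 2 / (q * (x + s) ^ 2)) x := by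
            have := ((hasDerivAt_id' x).mul_const s).div
              (((hasDerivAt_id' x).add_const s).const_mul q)
              (by positivity)
            refine this.congr_deriv ?_
            field_simp
            ring
          have d2 : HasDerivAt (fun x => s / (x + s)) (-(s / (x + s) ^ 2)) x := by
            have := (hasDerivAt_const x s).div ((hasDerivAt_id' x).add_const s)
              (by positivity)
            refine this.congr_deriv ?_
            field_simp
            ring
          have := (((d1.sqrt hu.ne').arsinh).sub (d2.sqrt hw.ne')).const_mul (k * (4 / √s))
          refine this.congr_deriv ?_
          simp only [hf]
          rw [Real.sq_sqrt hu.le, Real.sqrt_mul hu.le]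
          congr 1
          rw [neg_div, sub_neg_eq_add]
          congr 1
          rw [smul_eq_mul, inv_mul_eq_div, div_div]
          congr 1
          ring
        · intro x hx
          have hx0 := hx.1
          positivity
    _ ≤ _ := by
        apply ENNReal.ofReal_le_ofReal
        have hz : √(s / (0 + s)) = 1 := by rw [zero_add, div_self hs.ne', Real.sqrt_one]
        simp only [hF, zero_mul, zero_div, Real.sqrt_zero, Real.arsinh_zero, hz]
        rw [← mul_sub]
        refine mul_le_mul_of_nonneg_left ?_ (by positivity)
        have : 0 ≤ √(s / (p + s)) := Real.sqrt_nonneg _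
        linarith

theorem setLIntegral_quartic_le {p q s : ℝ} (hp : 0 < p) (hq : 0 < q) (hqs : q < s) :
    ∫⁻ x in Ioo 0 p, ENNReal.ofReal (1 / √((p - x) * (x * (x + q) * (x + s)))) ≤
      ENNReal.ofReal (14 * (2 / √((p + q) * s)) *
        (1 + Real.log ((p + q) * s / (q * (p + s))) / 2)) := by
  have hs : 0 < s := hq.trans hqs
  set R := (p + q) * s / (q * (p + s)) with hR
  have hR1 : 1 ≤ R := by
    rw [hR, one_le_div (by positivity)]
    nlinarith
  have hlog : 0 ≤ Real.log R := Real.log_nonneg hR1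
  set M := 2 / √(p * (p + q) * s) with hM
  have hM0 : 0 ≤ M := by positivity
  have hMsq : M ^ 2 = 4 / (p * (p + q) * s) := by
    rw [hM, div_pow, Real.sq_sqrt (by positivity)]
    norm_num
  have hMp : 2 * M * √p = 4 / √((p + q) * s) := by
    have : 0 < √p := Real.sqrt_pos.2 hp
    rw [hM, mul_assoc p, Real.sqrt_mul hp.le]
    field_simp
    norm_num
  have right {x : ℝ} (hx : x ∈ Ioo 0 p) (h : p ≤ 2 * x) :
      1 / √((p - x) * (x * (x + q) * (x + s))) ≤ M * (1 / √(p - x)) := by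
    have hx0 := hx.1
    have hy : 0 < p - x := sub_pos.2 hx.2
    refine one_div_sqrt_le_mul_div_sqrt (by positivity) hy hM0 zero_le_one ?_
    have e : M ^ 2 * 1 ^ 2 * ((p - x) * (x * (x + q) * (x + s))) =
        (p - x) * ((2 * x) * (2 * (x + q)) * (x + s)) / (p * (p + q) * s) := by
      rw [hMsq]
      ring
    rw [e, le_div_iff₀ (by positivity)]
    have h1 : p + q ≤ 2 * (x + q) := by linarith
    have h2 : s ≤ x + s := by linarith
    gcongr
  have split {G : ℝ → ℝ} {B : ℝ} (hG : Measurable G) (hB : 0 ≤ B) (hGB : ∫⁻ x in Ioo 0 p, ENNReal.ofReal (G x) ≤ ENNReal.ofReal B)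
      (hle : ∀ x ∈ Ioo 0 p, 2 * x ≤ p → 1 / √((p - x) * (x * (x + q) * (x + s))) ≤ G x) :
      ∫⁻ x in Ioo 0 p, ENNReal.ofReal (1 / √((p - x) * (x * (x + q) * (x + s)))) ≤
        ENNReal.ofReal (4 / √((p + q) * s) + B) := by
    calc _ ≤ ∫⁻ x in Ioo 0 p, (ENNReal.ofReal (M * (1 / √(p - x))) + ENNReal.ofReal (G x)) := by
          refine setLIntegral_mono' measurableSet_Ioo fun x hx => ?_
          rcases le_total p (2 * x) with h | h
          · exact (ENNReal.ofReal_le_ofReal (right hx h)).trans le_self_add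
          · exact (ENNReal.ofReal_le_ofReal (hle x hx h)).trans le_add_self
      _ = (∫⁻ x in Ioo 0 p, ENNReal.ofReal (M * (1 / √(p - x)))) +
            ∫⁻ x in Ioo 0 p, ENNReal.ofReal (G x) := lintegral_add_right _ hG.ennreal_ofReal
      _ ≤ _ := by
          rw [setLIntegral_div_sqrt_sub hp hM0, hMp, ENNReal.ofReal_add (by positivity) hB]
          gcongr
  have hw : 0 < √((p + q) * s) := by positivity
  rcases le_or_gt p q with hpq | hpq
  · refine (split (G := fun x => M * (1 / √x)) (B := 4 / √((p + q) * s)) (by fun_prop) (by positivity)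
      (by rw [setLIntegral_div_sqrt hp hM0, hMp]) ?_).trans ?_
    · intro x hx h
      have hx0 := hx.1
      have hy : 0 < p - x := sub_pos.2 hx.2
      refine one_div_sqrt_le_mul_div_sqrt (by positivity) hx0 hM0 zero_le_one ?_
      have e : M ^ 2 * 1 ^ 2 * ((p - x) * (x * (x + q) * (x + s))) =
          x * ((2 * (p - x)) * (2 * (x + q)) * (x + s)) / (p * (p + q) * s) := by
        rw [hMsq]
        ring
      rw [e, le_div_iff₀ (by positivity)]
      have h0 : p ≤ 2 * (p - x) := by linarith
      have h1 : p + q ≤ 2 * (x + q) := by linarith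
      have h2 : s ≤ x + s := by linarith
      gcongr
    · apply ENNReal.ofReal_le_ofReal
      rw [show 4 / √((p + q) * s) + 4 / √((p + q) * s) = 8 / √((p + q) * s) by ring,
        show 14 * (2 / √((p + q) * s)) * (1 + Real.log R / 2) =
          (28 + 14 * Real.log R) / √((p + q) * s) by ring]
      gcongr
      linarith
  · have hbd := setLIntegral_cubic_le (k := 2 / √(p + q)) hp hq hqs (by positivity)
    have har : Real.arsinh √(p * s / (q * (p + s))) ≤ 2 + Real.log R / 2 := by
      refine arsinh_sqrt_le (by positivity) ?_
      have e1 : 1 + p * s / (q * (p + s)) = (q * (p + s) + p * s) / (q * (p + s)) := by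
        field_simp
      rw [e1, hR, ← mul_div_assoc]
      gcongr
      nlinarith [mul_pos hp hs, mul_pos hq hs]
    have har0 : 0 ≤ Real.arsinh √(p * s / (q * (p + s))) :=
      Real.arsinh_nonneg_iff.2 (Real.sqrt_nonneg _)
    refine (split (by fun_prop) (by positivity) hbd ?_).trans ?_
    · intro x hx h
      have hx0 := hx.1
      have hy : 0 < p - x := sub_pos.2 hx.2
      refine one_div_sqrt_le_mul_div_sqrt (by positivity) (by positivity) (by positivity)
        zero_le_one ?_
      rw [div_pow, Real.sq_sqrt (by positivity)]
      have e : 2 ^ 2 / (p + q) * 1 ^ 2 * ((p - x) * (x * (x + q) * (x + s))) =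
          (x * (x + q) * (x + s)) * (4 * (p - x)) / (p + q) := by ring
      rw [e, le_div_iff₀ (by positivity)]
      have : p + q ≤ 4 * (p - x) := by linarith
      gcongr
    · apply ENNReal.ofReal_le_ofReal
      rw [Real.sqrt_mul (by positivity)]
      have e1 (A : ℝ) : 4 / (√(p + q) * √s) + 2 / √(p + q) * (4 / √s) * (A + 1) =
          (12 + 8 * A) / (√(p + q) * √s) := by
        field_simp
        ring
      rw [e1, show 14 * (2 / (√(p + q) * √s)) * (1 + Real.log R / 2) =
          (28 + 14 * Real.log R) / (√(p + q) * √s) by ring]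
      exact div_le_div_of_nonneg_right (by linarith) (by positivity)

theorem stmt14 :
    ∃ C₁ : ℝ, 0 < C₁ ∧ ∀ a b c d : ℝ, b < a → c < b → d < c →
      (∫⁻ lam in Set.Ioo d c ∪ Set.Ioo b a,
          ENNReal.ofReal (1 / Real.sqrt (-((lam - a) * (lam - b) * (lam - c) * (lam - d)))))
        ≤ ENNReal.ofReal (C₁ * (2 / Real.sqrt ((a - c) * (b - d))) *
            (1 - Real.log (Real.sqrt (1 - ((a - b) * (c - d)) / ((a - c) * (b - d)))))) := by
  refine ⟨28, by norm_num, fun a b c d hba hcb hdc => ?_⟩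
  have hac : 0 < a - c := by linarith
  have hbd : 0 < b - d := by linarith
  have had : 0 < a - d := by linarith
  have hbc : 0 < b - c := by linarith
  set R := (a - c) * (b - d) / ((b - c) * (a - d)) with hR
  have hR1 : 1 ≤ R := by
    rw [hR, one_le_div (by positivity)]
    nlinarith [mul_pos (sub_pos.2 hba) (sub_pos.2 hdc)]
  have hlog : 0 ≤ Real.log R := Real.log_nonneg hR1
  have hRinv : 1 - ((a - b) * (c - d)) / ((a - c) * (b - d)) = R⁻¹ := by
    rw [hR]
    field_simp
    ring
  have upper := setLIntegral_quartic_le (p := a - b) (q := b - c) (s := b - d)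
    (by linarith) hbc (by linarith)
  have lower := setLIntegral_quartic_le (p := c - d) (q := b - c) (s := a - c)
    (by linarith) hbc (by linarith)
  rw [show (a - b + (b - c)) = a - c by ring, show a - b + (b - d) = a - d by ring, ← hR] at upper
  rw [show (c - d + (b - c)) * (a - c) = (a - c) * (b - d) by ring,
    show c - d + (a - c) = a - d by ring, ← hR] at lower
  have tu : ∫⁻ lam in Ioo b a,
      ENNReal.ofReal (1 / √(-((lam - a) * (lam - b) * (lam - c) * (lam - d)))) =
      ∫⁻ x in Ioo 0 (a - b), ENNReal.ofReal
        (1 / √((a - b - x) * (x * (x + (b - c)) * (x + (b - d))))) := by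
    rw [← (measurePreserving_add_left volume b).setLIntegral_comp_preimage_emb
      (measurableEmbedding_addLeft b)]
    simp only [preimage_const_add_Ioo, sub_self]
    congr! 5 with x
    ring
  have tl : ∫⁻ lam in Ioo d c,
      ENNReal.ofReal (1 / √(-((lam - a) * (lam - b) * (lam - c) * (lam - d)))) =
      ∫⁻ x in Ioo 0 (c - d), ENNReal.ofReal
        (1 / √((c - d - x) * (x * (x + (b - c)) * (x + (a - c))))) := by
    rw [← (Measure.measurePreserving_sub_left volume c).setLIntegral_comp_preimage_emb
      (MeasurableEquiv.subLeft c).measurableEmbedding]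
    simp only [preimage_const_sub_Ioo, sub_self]
    congr! 5 with x
    ring
  refine (lintegral_union_le _ _ _).trans ?_
  rw [tu, tl]
  refine (add_le_add lower upper).trans ?_
  rw [← ENNReal.ofReal_add (by positivity) (by positivity)]
  apply ENNReal.ofReal_le_ofReal
  rw [hRinv, Real.log_sqrt (by positivity), Real.log_inv]
  apply le_of_eq
  ring
end

section
/- Let a > y > b > c > d be real numbers and suppose there exist positive constants C₂ < 1 and C₃ with (y−b)/(a−b) ≤ C₂ and (y−b)/(b−c) ≤ C₃. Then there is a positive constant C₄ depending only on C₂ and C₃ (independent of a, b, c, d, y) such that ∫_{b}^{y} dλ / √( −(λ−a)(λ−b)(λ−c)(λ−d) ) ≤ C₄ · g, where g := 2/√((a−c)(b−d)). -/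
open scoped ENNReal

/-- The integral of `1 / √(x - b)` over `(b, y]` is `2 √(y - b)`. -/
lemma lintegral_Ioc_one_div_sqrt_sub {b y : ℝ} (hby : b ≤ y) :
    ∫⁻ x in Set.Ioc b y, ENNReal.ofReal (1 / √(x - b)) = ENNReal.ofReal (2 * √(y - b)) := by
  have hcont : ContinuousOn (fun x : ℝ => 2 * √(x - b)) (Set.Icc b y) := by fun_prop
  have hderiv : ∀ x ∈ Set.Ioo b y, HasDerivAt (fun x : ℝ => 2 * √(x - b)) (1 / √(x - b)) x := by
    intro x hx
    have h := (((hasDerivAt_id' x).sub_const b).sqrt (sub_pos.2 hx.1).ne').const_mul 2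
    exact h.congr_deriv (by ring)
  have hint : MeasureTheory.IntegrableOn (fun x : ℝ => 1 / √(x - b)) (Set.Ioc b y) :=
    intervalIntegral.integrableOn_deriv_of_nonneg hcont hderiv fun x _ => by positivity
  rw [← MeasureTheory.ofReal_integral_eq_lintegral_ofReal hint
      (Filter.Eventually.of_forall fun x => by positivity),
    ← intervalIntegral.integral_of_le hby,
    intervalIntegral.integral_eq_sub_of_hasDerivAt_of_le hby hcont hderiv
      ((intervalIntegrable_iff_integrableOn_Ioc_of_le hby).2 hint)]
  simp

theorem stmt15 (C₂ C₃ : ℝ) (hC₂0 : 0 < C₂) (hC₂1 : C₂ < 1) (hC₃ : 0 < C₃) :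
    ∃ C₄ : ℝ, 0 < C₄ ∧ ∀ a y b c d : ℝ, y < a → b < y → c < b → d < c →
      (y - b) / (a - b) ≤ C₂ → (y - b) / (b - c) ≤ C₃ →
      (∫⁻ lam in Set.Ioc b y,
          ENNReal.ofReal (1 / Real.sqrt (-((lam - a) * (lam - b) * (lam - c) * (lam - d)))))
        ≤ ENNReal.ofReal (C₄ * (2 / Real.sqrt ((a - c) * (b - d)))) := by
  have hC : 0 < 1 - C₂ := sub_pos.2 hC₂1
  refine ⟨√((C₂ + C₃) / (1 - C₂)), by positivity, ?_⟩
  intro a y b c d hya hby hcb hdc h₂ h₃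
  have hab : 0 < a - b := by linarith
  have hbc : 0 < b - c := by linarith
  have hbd : 0 < b - d := by linarith
  have hac : 0 < a - c := by linarith
  rw [div_le_iff₀ hab] at h₂
  rw [div_le_iff₀ hbc] at h₃
  set P := (1 - C₂) * (a - b) * (b - c) * (b - d) with hP
  have hP0 : 0 < P := by positivity
  calc
    _ ≤ ∫⁻ x in Set.Ioc b y, ENNReal.ofReal (1 / √P) * ENNReal.ofReal (1 / √(x - b)) := by
      refine MeasureTheory.setLIntegral_mono' measurableSet_Ioc fun x hx => ?_
      have hxb : 0 < x - b := sub_pos.2 hx.1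
      have hax : (1 - C₂) * (a - b) ≤ a - x := by linarith [hx.2]
      rw [← ENNReal.ofReal_mul (by positivity), one_div_mul_one_div, ← Real.sqrt_mul hP0.le]
      refine ENNReal.ofReal_le_ofReal (one_div_le_one_div_of_le (by positivity)
        (Real.sqrt_le_sqrt ?_))
      calc P * (x - b) ≤ (a - x) * (x - c) * (x - d) * (x - b) := by
            rw [hP]
            have : 0 < a - x := lt_of_lt_of_le (by positivity) hax
            have : b - c ≤ x - c := by linarith
            have : b - d ≤ x - d := by linarith
            have : 0 < x - c := by linarith
            gcongr
        _ = _ := by ring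
    _ = ENNReal.ofReal (1 / √P * (2 * √(y - b))) := by
      rw [MeasureTheory.lintegral_const_mul' _ _ ENNReal.ofReal_ne_top,
        lintegral_Ioc_one_div_sqrt_sub hby.le, ← ENNReal.ofReal_mul (by positivity)]
    _ ≤ _ := by
      refine ENNReal.ofReal_le_ofReal ?_
      have key : √((y - b) / P) ≤ √((C₂ + C₃) / (1 - C₂) / ((a - c) * (b - d))) := by
        refine Real.sqrt_le_sqrt ?_
        rw [div_div, div_le_div_iff₀ hP0 (by positivity), hP]
        have h : (y - b) * (a - c) ≤ (C₂ + C₃) * ((a - b) * (b - c)) := by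
          linarith [mul_le_mul_of_nonneg_right h₂ hbc.le, mul_le_mul_of_nonneg_right h₃ hab.le]
        linarith [mul_le_mul_of_nonneg_right h (mul_pos hC hbd).le]
      rw [Real.sqrt_div' _ hP0.le, Real.sqrt_div' _ (by positivity : 0 ≤ (a - c) * (b - d))] at key
      calc _ = 2 * (√(y - b) / √P) := by ring
        _ ≤ 2 * (√((C₂ + C₃) / (1 - C₂)) / √((a - c) * (b - d))) := by gcongr
        _ = _ := by ring
end

section
/- There exist a constant c > 0 and a positive integer N₀ such that for every δ ∈ [0, 1/2), every integer N ≥ N₀, and n := (−2N, 0, 0) ∈ ℤ³, the number of k ∈ ℤ³ with k₃ ≠ 0 satisfying both |n| ≥ |k| ≥ |n+k| ≥ |n|/3 and | n₃/|n| + k₃/|k| − (n₃+k₃)/|n+k| | ≤ δ is at least c ( |n|² + |n|³ δ log(1/δ) ), where for δ = 0 the term δ log(1/δ) is interpreted as 0. -/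
open scoped BigOperators ENNReal

/-- Euclidean norm of an integer vector in ℤ³ (aspect ratios L₁ = L₂ = 1). -/
noncomputable def enorm3 (n : Fin 3 → ℤ) : ℝ :=
  Real.sqrt ((n 0 : ℝ) ^ 2 + (n 1 : ℝ) ^ 2 + (n 2 : ℝ) ^ 2)

/-- The wavevectors `k` that are near-resonant with `n` at bandwidth `δ`. -/
def nearResonantSet (n : Fin 3 → ℤ) (δ : ℝ) : Set (Fin 3 → ℤ) :=
  {k | k 2 ≠ 0 ∧
    enorm3 k ≤ enorm3 n ∧ enorm3 (n + k) ≤ enorm3 k ∧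
    enorm3 n / 3 ≤ enorm3 (n + k) ∧
    |(n 2 : ℝ) / enorm3 n + (k 2 : ℝ) / enorm3 k -
      ((n 2 + k 2 : ℤ) : ℝ) / enorm3 (n + k)| ≤ δ}

lemma enorm3_neg_two_mul (N : ℕ) : enorm3 ![-2 * (N : ℤ), 0, 0] = 2 * N := by
  rw [enorm3, ← Real.sqrt_sq (by positivity : (0 : ℝ) ≤ 2 * N)]
  congr 1
  simp

lemma abs_div_sub_div_le {N a z p q δ : ℝ} (hN : 0 < N) (ha : 0 ≤ a) (hz : 0 ≤ z)
    (hp : 2 * N / 3 ≤ p) (hq : 2 * N / 3 ≤ q) (hpq : p ^ 2 - q ^ 2 = 4 * N * a)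
    (h : 7 * (a * z) ≤ δ * N ^ 2) : |z / p - z / q| ≤ δ := by
  have hp0 : 0 < p := by linarith
  have hq0 : 0 < q := by linarith
  have hδ : 0 ≤ δ := by
    by_contra! hlt
    nlinarith [mul_nonneg ha hz, mul_pos (neg_pos.2 hlt) (pow_pos hN 2)]
  have hqp : q ≤ p := by
    refine le_of_sq_le_sq ?_ hp0.le
    nlinarith [mul_nonneg hN.le ha]
  have hle : z / p ≤ z / q := by gcongr
  rw [abs_sub_comm, abs_of_nonneg (by linarith), div_sub_div _ _ hq0.ne' hp0.ne',
    div_le_iff₀ (mul_pos hq0 hp0)]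
  have hprod : (2 * N / 3) * (2 * N / 3) ≤ q * p := by gcongr
  have hprod' : (2 * N / 3 + 2 * N / 3) * ((2 * N / 3) * (2 * N / 3)) ≤ (p + q) * (q * p) := by
    gcongr
  have hs : 0 < p + q := by linarith
  refine le_of_mul_le_mul_left ?_ hs
  calc (p + q) * (z * p - q * z) = z * (p ^ 2 - q ^ 2) := by ring
    _ = 4 * N * (a * z) := by rw [hpq]; ring
    _ ≤ δ * ((2 * N / 3 + 2 * N / 3) * ((2 * N / 3) * (2 * N / 3))) := by
        nlinarith [mul_le_mul_of_nonneg_left h hN.le, mul_nonneg hδ (pow_pos hN 3).le]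
    _ ≤ δ * ((p + q) * (q * p)) := by gcongr
    _ = (p + q) * (δ * (q * p)) := by ring

lemma mem_nearResonantSet {N a y z : ℕ} {δ : ℝ} (hN : 0 < N) (ha : 3 * a ≤ N) (hy : 3 * y ≤ N)
    (hz : 3 * z ≤ N) (hz1 : 1 ≤ z) (h : 7 * ((a : ℝ) * z) ≤ δ * (N : ℝ) ^ 2) :
    ![(N : ℤ) + a, (y : ℤ), (z : ℤ)] ∈ nearResonantSet ![-2 * (N : ℤ), 0, 0] δ := by
  have hN' : (0 : ℝ) < N := by exact_mod_cast hN
  have ha' : 3 * (a : ℝ) ≤ N := by exact_mod_cast ha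
  have hy' : 3 * (y : ℝ) ≤ N := by exact_mod_cast hy
  have hz' : 3 * (z : ℝ) ≤ N := by exact_mod_cast hz
  have ha0 : (0 : ℝ) ≤ a := a.cast_nonneg
  have hy0 : (0 : ℝ) ≤ y := y.cast_nonneg
  have hz0 : (0 : ℝ) ≤ z := z.cast_nonneg
  have hn := enorm3_neg_two_mul N
  have hk : enorm3 ![(N : ℤ) + a, (y : ℤ), (z : ℤ)] =
      √(((N : ℝ) + a) ^ 2 + (y : ℝ) ^ 2 + (z : ℝ) ^ 2) := by
    simp [enorm3]
  have hm : enorm3 (![-2 * (N : ℤ), 0, 0] + ![(N : ℤ) + a, (y : ℤ), (z : ℤ)]) =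
      √(((N : ℝ) - a) ^ 2 + (y : ℝ) ^ 2 + (z : ℝ) ^ 2) := by
    rw [enorm3]
    congr 1
    simp
    ring
  have hkm : √(((N : ℝ) - a) ^ 2 + (y : ℝ) ^ 2 + (z : ℝ) ^ 2) ≤
      √(((N : ℝ) + a) ^ 2 + (y : ℝ) ^ 2 + (z : ℝ) ^ 2) := by
    apply Real.sqrt_le_sqrt
    nlinarith
  have hq : 2 * (N : ℝ) / 3 ≤ √(((N : ℝ) - a) ^ 2 + (y : ℝ) ^ 2 + (z : ℝ) ^ 2) := by
    apply Real.le_sqrt_of_sq_le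
    nlinarith [sq_nonneg (y : ℝ), sq_nonneg (z : ℝ)]
  refine ⟨?_, ?_, ?_, ?_, ?_⟩
  · simp only [Matrix.cons_val]
    omega
  · rw [hk, hn]
    apply Real.sqrt_le_iff.2 ⟨by positivity, ?_⟩
    nlinarith
  · rw [hk, hm]
    exact hkm
  · rw [hm, hn]
    exact hq
  · rw [hk, hm, hn]
    have := abs_div_sub_div_le hN' ha0 hz0 (hq.trans hkm) hq
      (by rw [Real.sq_sqrt (by positivity), Real.sq_sqrt (by positivity)]; ring) h
    simpa using this

lemma card_mul_le_encard_nearResonantSet {N : ℕ} {δ : ℝ} (hN : 0 < N) (T : Finset (ℕ × ℕ))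
    (hT : ∀ t ∈ T, 3 * t.1 ≤ N ∧ 3 * t.2 ≤ N ∧ 1 ≤ t.2 ∧
      7 * ((t.1 : ℝ) * t.2) ≤ δ * (N : ℝ) ^ 2) :
    ENNReal.ofReal (T.card * (N / 3)) ≤
      ((nearResonantSet ![-2 * (N : ℤ), 0, 0] δ).encard : ℕ∞) := by
  classical
  let f : (ℕ × ℕ) × ℕ → (Fin 3 → ℤ) := fun t => ![(N : ℤ) + t.1.1, (t.2 : ℤ), (t.1.2 : ℤ)]
  have hf : Function.Injective f := by
    rintro ⟨⟨a, z⟩, y⟩ ⟨⟨a', z'⟩, y'⟩ h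
    have h0 := congrFun h 0
    have h1 := congrFun h 1
    have h2 := congrFun h 2
    simp only [f, Matrix.cons_val] at h0 h1 h2
    simp only [Prod.mk.injEq]
    omega
  let S := (T ×ˢ Finset.range (N / 3 + 1)).image f
  have hcard : S.card = T.card * (N / 3 + 1) := by
    rw [Finset.card_image_of_injective _ hf, Finset.card_product, Finset.card_range]
  have hS : (S : Set (Fin 3 → ℤ)) ⊆ nearResonantSet ![-2 * (N : ℤ), 0, 0] δ := by
    intro k hk
    obtain ⟨⟨⟨a, z⟩, y⟩, ht, rfl⟩ := Finset.mem_image.1 (Finset.mem_coe.1 hk)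
    obtain ⟨ht, hy⟩ := Finset.mem_product.1 ht
    obtain ⟨h1, h2, h3, h4⟩ := hT _ ht
    rw [Finset.mem_range] at hy
    exact mem_nearResonantSet hN h1 (by dsimp only at hy; omega) h2 h3 h4
  have hle := Set.encard_le_encard hS
  rw [Set.encard_coe_eq_coe_finsetCard, hcard] at hle
  have hdiv : (N : ℝ) / 3 ≤ ((N / 3 + 1 : ℕ) : ℝ) := by
    rw [div_le_iff₀ (by norm_num)]
    exact_mod_cast (by omega : N ≤ (N / 3 + 1) * 3)
  calc ENNReal.ofReal (T.card * (N / 3))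
      ≤ ENNReal.ofReal ((T.card * (N / 3 + 1) : ℕ) : ℝ) := by
        apply ENNReal.ofReal_le_ofReal
        rw [Nat.cast_mul]
        gcongr
    _ = (((T.card * (N / 3 + 1) : ℕ) : ℕ∞) : ℝ≥0∞) := by
        rw [ENNReal.ofReal_natCast, ENat.toENNReal_coe]
    _ ≤ _ := by exact_mod_cast hle

lemma log_div_le_sum_Icc_inv {A : ℕ} (hA : 0 < A) {B : ℕ} (hAB : A ≤ B) :
    Real.log (((B : ℝ) + 1) / A) ≤ ∑ a ∈ Finset.Icc A B, (a : ℝ)⁻¹ := by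
  have hlog : ∀ a : ℕ, 0 < a → Real.log (((a : ℝ) + 1) / a) ≤ (a : ℝ)⁻¹ := by
    intro a ha
    have ha' : (0 : ℝ) < a := by exact_mod_cast ha
    refine (Real.log_le_sub_one_of_pos (by positivity)).trans_eq ?_
    field_simp
    ring
  induction B, hAB using Nat.le_induction with
  | base => simpa using hlog A hA
  | succ B hAB ih =>
    have hA' : (0 : ℝ) < A := by exact_mod_cast hA
    rw [← Finset.insert_Icc_right_eq_Icc_add_one (by omega), Finset.sum_insert (by simp)]
    have h := hlog (B + 1) (by omega)
    have hsplit : (((B + 1 : ℕ) : ℝ) + 1) / A =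
        (((B + 1 : ℕ) : ℝ) + 1) / ((B + 1 : ℕ) : ℝ) * (((B : ℝ) + 1) / A) := by
      push_cast
      field_simp
    rw [hsplit, Real.log_mul (by positivity) (by positivity)]
    linarith

/-- Lattice points under a hyperbola, with abscissa in `[A, B]`. -/
lemma exists_finset_hyperbola {A B K : ℕ} {M : ℝ} (hA : 0 < A) (hAB : A ≤ B) (hBM : (B : ℝ) ≤ M)
    (hMK : M ≤ K * A) :
    ∃ T : Finset (ℕ × ℕ), (∀ t ∈ T, t.1 ≤ B ∧ t.2 ≤ K ∧ 1 ≤ t.2 ∧ (t.1 : ℝ) * t.2 ≤ M) ∧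
      M / 2 * Real.log (((B : ℝ) + 1) / A) ≤ T.card := by
  have hM0 : 0 ≤ M := B.cast_nonneg.trans hBM
  let S := (Finset.Icc A B).sigma fun a => Finset.Icc 1 ⌊M / a⌋₊
  refine ⟨S.map (Equiv.sigmaEquivProd ℕ ℕ).toEmbedding, ?_, ?_⟩
  · intro t ht
    obtain ⟨⟨a, z⟩, hs, rfl⟩ := Finset.mem_map.1 ht
    obtain ⟨ha, hz⟩ := Finset.mem_sigma.1 hs
    simp only [Finset.mem_Icc] at ha hz
    have ha0 : (0 : ℝ) < a := by exact_mod_cast hA.trans_le ha.1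
    have haA : (A : ℝ) ≤ a := by exact_mod_cast ha.1
    have hzM : (z : ℝ) ≤ M / a := (Nat.le_floor_iff (by positivity)).1 hz.2
    refine ⟨ha.2, ?_, hz.1, ?_⟩
    · have : (z : ℝ) ≤ K := by
        refine hzM.trans ((div_le_iff₀ ha0).2 (hMK.trans ?_))
        gcongr
      exact_mod_cast this
    · rw [le_div_iff₀ ha0] at hzM
      simpa [mul_comm] using hzM
  · rw [Finset.card_map, Finset.card_sigma, Nat.cast_sum]
    calc M / 2 * Real.log (((B : ℝ) + 1) / A)
        ≤ M / 2 * ∑ a ∈ Finset.Icc A B, (a : ℝ)⁻¹ := by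
          gcongr
          exact log_div_le_sum_Icc_inv hA hAB
      _ = ∑ a ∈ Finset.Icc A B, M / 2 * (a : ℝ)⁻¹ := Finset.mul_sum _ _ _
      _ ≤ _ := by
          refine Finset.sum_le_sum fun a ha => ?_
          rw [Finset.mem_Icc] at ha
          have ha0 : (0 : ℝ) < a := by exact_mod_cast hA.trans_le ha.1
          have haB : (a : ℝ) ≤ B := by exact_mod_cast ha.2
          have h1 : 1 ≤ M / a := (one_le_div ha0).2 (haB.trans hBM)
          have h2 : (1 : ℝ) ≤ ⌊M / a⌋₊ := by exact_mod_cast Nat.one_le_floor_iff _ |>.2 h1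
          have h3 := Nat.lt_floor_add_one (M / a)
          rw [Nat.card_Icc, Nat.add_sub_cancel]
          have : M / 2 * (a : ℝ)⁻¹ = (M / a) / 2 := by ring
          linarith

lemma mul_log_one_div_le {δ N : ℝ} (hδ : 0 ≤ δ) (hN : 0 ≤ N) (h : δ ^ 3 * N ^ 4 ≤ 1) :
    N * (δ * Real.log (1 / δ)) ≤ 4 := by
  obtain ⟨s, hs, rfl⟩ : ∃ s : ℝ, 0 ≤ s ∧ s ^ 4 = δ :=
    ⟨√√δ, Real.sqrt_nonneg _, by
      rw [show (4 : ℕ) = 2 * 2 from rfl, pow_mul, Real.sq_sqrt (Real.sqrt_nonneg _),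
        Real.sq_sqrt hδ]⟩
  rcases hs.eq_or_lt with rfl | hs
  · simp
  have h1 : N * s ^ 3 ≤ 1 := by
    refine le_of_pow_le_pow_left₀ (n := 4) (by norm_num) zero_le_one ?_
    calc (N * s ^ 3) ^ 4 = (s ^ 4) ^ 3 * N ^ 4 := by ring
      _ ≤ 1 ^ 4 := by simpa using h
  have h2 : Real.log (1 / s ^ 4) ≤ 4 * (1 / s) := by
    rw [← one_div_pow, Real.log_pow]
    have := Real.log_le_self (one_div_pos.2 hs).le
    push_cast
    linarith
  calc N * (s ^ 4 * Real.log (1 / s ^ 4)) ≤ N * (s ^ 4 * (4 * (1 / s))) := by gcongr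
    _ = 4 * (N * s ^ 3) := by field_simp
    _ ≤ 4 := by linarith

lemma sq_le_encard_nearResonantSet {N : ℕ} {δ : ℝ} (hδ : 0 ≤ δ) (hN : 12 ≤ N) :
    ENNReal.ofReal ((N : ℝ) ^ 2 / 12) ≤
      ((nearResonantSet ![-2 * (N : ℤ), 0, 0] δ).encard : ℕ∞) := by
  refine le_trans ?_ (card_mul_le_encard_nearResonantSet (by omega)
    ({0} ×ˢ Finset.Icc 1 (N / 3)) ?_)
  · apply ENNReal.ofReal_le_ofReal
    have h : (N : ℝ) ≤ 4 * (N / 3 : ℕ) := by exact_mod_cast (by omega : N ≤ 4 * (N / 3))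
    rw [Finset.card_product, Finset.card_singleton, Nat.card_Icc, one_mul, Nat.add_sub_cancel]
    nlinarith [(N.cast_nonneg : (0 : ℝ) ≤ N)]
  · rintro ⟨a, z⟩ ht
    simp only [Finset.mem_product, Finset.mem_singleton, Finset.mem_Icc] at ht
    obtain ⟨rfl, hz⟩ := ht
    refine ⟨by omega, by dsimp only; omega, hz.1, ?_⟩
    simp only [Nat.cast_zero, zero_mul, mul_zero]
    positivity

lemma exists_range_le_log {N : ℕ} {δ : ℝ} (hδ : 0 < δ) (hδ' : δ < 1 / 2) (hN : 1000000 ≤ N)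
    (h : 1 ≤ δ ^ 3 * (N : ℝ) ^ 4) :
    ∃ A B : ℕ, 0 < A ∧ A ≤ B ∧ B ≤ N / 3 ∧ (B : ℝ) ≤ δ * (N : ℝ) ^ 2 / 100 ∧
      δ * (N : ℝ) ^ 2 / 100 ≤ ((N / 3 : ℕ) : ℝ) * A ∧
      Real.log (1 / δ) / 4 ≤ Real.log (((B : ℝ) + 1) / A) := by
  have hN' : (1000000 : ℝ) ≤ N := by exact_mod_cast hN
  have hK : (N : ℝ) ≤ 4 * (N / 3 : ℕ) := by exact_mod_cast (by omega : N ≤ 4 * (N / 3))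
  obtain ⟨M, hM⟩ : ∃ M : ℝ, M = δ * (N : ℝ) ^ 2 / 100 := ⟨_, rfl⟩
  rw [← hM]
  set K := N / 3
  have hK0 : (0 : ℝ) < K := by linarith
  have hM0 : 0 < M := by rw [hM]; positivity
  have hL : 0 ≤ Real.log (1 / δ) :=
    Real.log_nonneg ((one_le_div hδ).2 (by linarith))
  rcases le_or_gt (K : ℝ) M with hKM | hKM
  · have h1 : 1 ≤ M / K := (one_le_div hK0).2 hKM
    have hA : ((⌈M / K⌉₊ : ℕ) : ℝ) ≤ 2 * M / K := by
      have := (Nat.ceil_lt_add_one (by linarith : 0 ≤ M / K)).le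
      have : 2 * M / K = 2 * (M / K) := by ring
      linarith
    have hA0 : 0 < ⌈M / K⌉₊ := Nat.ceil_pos.2 (by linarith)
    have hA0' : (0 : ℝ) < (⌈M / K⌉₊ : ℕ) := by exact_mod_cast hA0
    have hKK : (N : ℝ) ^ 2 ≤ 16 * K ^ 2 := by nlinarith
    have hδM : 2 * M ≤ δ * K ^ 2 := by
      rw [hM]
      nlinarith [mul_le_mul_of_nonneg_left hKK hδ.le, mul_pos hδ (pow_pos hK0 2)]
    refine ⟨⌈M / K⌉₊, K, hA0, ?_, le_rfl, hKM, ?_, ?_⟩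
    · have : ((⌈M / K⌉₊ : ℕ) : ℝ) ≤ K := by
        refine hA.trans ((div_le_iff₀ hK0).2 ?_)
        nlinarith [pow_pos hK0 2]
      exact_mod_cast this
    · have := Nat.le_ceil (M / K)
      rw [div_le_iff₀ hK0] at this
      linarith
    · refine (by linarith : _ ≤ Real.log (1 / δ)).trans
        (Real.log_le_log (by positivity) ?_)
      rw [div_le_div_iff₀ hδ hA0', one_mul]
      refine hA.trans ((div_le_iff₀ hK0).2 ?_)
      nlinarith [mul_pos hδ hK0]
  · have hM3 : (100 : ℝ) ^ 3 ≤ M ^ 3 := by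
      have : M ^ 3 = δ ^ 3 * (N : ℝ) ^ 4 * N ^ 2 / 1000000 := by rw [hM]; ring
      rw [this]
      have : (1000000 : ℝ) ^ 2 ≤ (N : ℝ) ^ 2 := by gcongr
      nlinarith
    have hM100 : 100 ≤ M := le_of_pow_le_pow_left₀ (by norm_num) hM0.le hM3
    refine ⟨1, ⌊M⌋₊, one_pos, Nat.one_le_floor_iff _ |>.2 (by linarith), ?_,
      Nat.floor_le hM0.le, by simpa using hKM.le, ?_⟩
    · exact Nat.cast_le.1 ((Nat.floor_le hM0.le).trans hKM.le)
    · have h4 : 1 / δ ≤ M ^ 4 := by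
        rw [div_le_iff₀ hδ]
        have h5 : M ^ 2 * δ = δ ^ 3 * (N : ℝ) ^ 4 / 10000 := by rw [hM]; ring
        have h6 : (100 : ℝ) ^ 2 ≤ M ^ 2 := by gcongr
        nlinarith
      have h7 := Real.log_le_log (by positivity) h4
      rw [Real.log_pow] at h7
      push_cast at h7
      have h8 : Real.log M ≤ Real.log (((⌊M⌋₊ : ℝ) + 1) / (1 : ℕ)) := by
        apply Real.log_le_log hM0
        simpa using (Nat.lt_floor_add_one M).le
      linarith

lemma mul_log_le_encard_nearResonantSet {N : ℕ} {δ : ℝ} (hδ : 0 < δ) (hδ' : δ < 1 / 2)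
    (hN : 1000000 ≤ N) (h : 1 ≤ δ ^ 3 * (N : ℝ) ^ 4) :
    ENNReal.ofReal ((N : ℝ) ^ 3 * δ * Real.log (1 / δ) / 2400) ≤
      ((nearResonantSet ![-2 * (N : ℤ), 0, 0] δ).encard : ℕ∞) := by
  obtain ⟨A, B, hA, hAB, hBK, hBM, hMK, hlog⟩ := exists_range_le_log hδ hδ' hN h
  obtain ⟨T, hT, hcard⟩ := exists_finset_hyperbola hA hAB hBM hMK
  refine le_trans ?_ (card_mul_le_encard_nearResonantSet (by omega) T fun t ht => ?_)
  · apply ENNReal.ofReal_le_ofReal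
    calc (N : ℝ) ^ 3 * δ * Real.log (1 / δ) / 2400
        = δ * (N : ℝ) ^ 2 / 100 / 2 * (Real.log (1 / δ) / 4) * (N / 3) := by ring
      _ ≤ δ * (N : ℝ) ^ 2 / 100 / 2 * Real.log (((B : ℝ) + 1) / A) * (N / 3) := by gcongr
      _ ≤ T.card * (N / 3) := by gcongr
  · obtain ⟨h1, h2, h3, h4⟩ := hT t ht
    refine ⟨by omega, by omega, h3, ?_⟩
    have : 0 ≤ δ * (N : ℝ) ^ 2 := by positivity
    linarith

theorem stmt17 :
    ∃ c : ℝ, 0 < c ∧ ∃ N₀ : ℕ, 0 < N₀ ∧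
    ∀ δ : ℝ, 0 ≤ δ → δ < 1 / 2 →
    ∀ N : ℕ, N₀ ≤ N →
    ∀ n : Fin 3 → ℤ, n = ![-2 * (N : ℤ), 0, 0] →
    ENNReal.ofReal (c * (enorm3 n ^ 2 + enorm3 n ^ 3 * δ * Real.log (1 / δ)))
      ≤ (({k : Fin 3 → ℤ | k 2 ≠ 0 ∧
            enorm3 k ≤ enorm3 n ∧ enorm3 (n + k) ≤ enorm3 k ∧
            enorm3 n / 3 ≤ enorm3 (n + k) ∧
            |(n 2 : ℝ) / enorm3 n + (k 2 : ℝ) / enorm3 k -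
              ((n 2 + k 2 : ℤ) : ℝ) / enorm3 (n + k)| ≤ δ}.encard : ℕ∞) : ℝ≥0∞) := by
  refine ⟨1 / 20000, by norm_num, 1000000, by norm_num, ?_⟩
  rintro δ hδ hδ' N hN n rfl
  change _ ≤ (((nearResonantSet ![-2 * (N : ℤ), 0, 0] δ).encard : ℕ∞) : ℝ≥0∞)
  rw [enorm3_neg_two_mul]
  have hsq := sq_le_encard_nearResonantSet (N := N) hδ (by omega)
  rcases le_or_gt (δ ^ 3 * (N : ℝ) ^ 4) 1 with h | h
  · refine le_trans (ENNReal.ofReal_le_ofReal ?_) hsq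
    have := mul_log_one_div_le hδ N.cast_nonneg h
    nlinarith [mul_le_mul_of_nonneg_left this (sq_nonneg (N : ℝ))]
  · have hδ0 : 0 < δ := by
      refine hδ.lt_of_ne ?_
      rintro rfl
      norm_num at h
    have hlog := mul_log_le_encard_nearResonantSet hδ0 hδ' hN h.le
    refine le_trans (ENNReal.ofReal_le_ofReal ?_)
      ((ENNReal.ofReal_max _ _).trans_le (max_le hsq hlog))
    have h1 := le_max_left ((N : ℝ) ^ 2 / 12) ((N : ℝ) ^ 3 * δ * Real.log (1 / δ) / 2400)
    have h2 := le_max_right ((N : ℝ) ^ 2 / 12) ((N : ℝ) ^ 3 * δ * Real.log (1 / δ) / 2400)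
    nlinarith [sq_nonneg (N : ℝ)]
end

section
/- There exist constants c > 0, C₀ > 0 and a positive integer N₀ such that for every integer N ≥ N₀ and every δ ∈ (0, 1/2) with δ |n|² ≥ C₀, where n := (−2N, 0, −1) ∈ ℤ³, the number of k ∈ ℤ³ with n₃ k₃ (n₃ + k₃) ≠ 0 satisfying both |n| ≥ |k| ≥ |n+k| ≥ |n|/3 and | n₃/|n| + k₃/|k| − (n₃+k₃)/|n+k| | ≤ δ is at least c ( |n|² · min{1, (δ|n|)^{3/2}} + |n|³ δ · min{ log(1/δ), δ|n| log|n| } ). -/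
open scoped BigOperators ENNReal

/-- The near-resonant triads of the theorem, for the wavevector `n`. -/
def nearResonant (n : Fin 3 → ℤ) (δ : ℝ) : Set (Fin 3 → ℤ) :=
  {k : Fin 3 → ℤ | (n 2) * (k 2) * (n 2 + k 2) ≠ 0 ∧
    enorm3 k ≤ enorm3 n ∧ enorm3 (n + k) ≤ enorm3 k ∧
    enorm3 n / 3 ≤ enorm3 (n + k) ∧
    |(n 2 : ℝ) / enorm3 n + (k 2 : ℝ) / enorm3 k -
      ((n 2 + k 2 : ℤ) : ℝ) / enorm3 (n + k)| ≤ δ}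

lemma one_div_sub_one_div_le {N K L : ℝ} (hN : 0 < N) (hL : N ≤ L) (hK : L ≤ K) :
    1 / L - 1 / K ≤ (K ^ 2 - L ^ 2) / (2 * N ^ 3) := by
  have hL0 : 0 < L := by linarith
  have hK0 : 0 < K := by linarith
  have h : 1 / L - 1 / K = (K ^ 2 - L ^ 2) / (K * L * (K + L)) := by
    field_simp
    ring
  rw [h]
  have hNK : N ≤ K := hL.trans hK
  apply div_le_div_of_nonneg_left
  · nlinarith
  · positivity
  · calc 2 * N ^ 3 = N * N * (N + N) := by ring
      _ ≤ K * L * (K + L) := by gcongr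

lemma abs_resonance_le {N K L R z δ : ℝ} (hN : 0 < N) (hL : N ≤ L) (hLK : L ≤ K) (hKR : K ≤ R)
    (hz : 0 ≤ z) (hzD : z * (K ^ 2 - L ^ 2) ≤ 2 * δ * N ^ 3)
    (hRL : R ^ 2 - L ^ 2 ≤ 2 * δ * N ^ 3) :
    |-1 / R + z / K - (-1 + z) / L| ≤ δ := by
  have hL0 : 0 < L := by linarith
  have h1 := one_div_sub_one_div_le hN hL hLK
  have h2 := one_div_sub_one_div_le hN hL (hLK.trans hKR)
  have h3 : 1 / K ≤ 1 / L := one_div_le_one_div_of_le hL0 hLK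
  have h4 : 1 / R ≤ 1 / L := one_div_le_one_div_of_le hL0 (hLK.trans hKR)
  have h5 : (R ^ 2 - L ^ 2) / (2 * N ^ 3) ≤ δ := by
    rw [div_le_iff₀ (by positivity)]
    linarith
  have h6 : z * (1 / L - 1 / K) ≤ δ := by
    refine (mul_le_mul_of_nonneg_left h1 hz).trans ?_
    rw [← mul_div_assoc, div_le_iff₀ (by positivity)]
    linarith
  have h7 : 0 ≤ z * (1 / L - 1 / K) := mul_nonneg hz (by linarith)
  have h8 : -1 / R + z / K - (-1 + z) / L = (1 / L - 1 / R) - z * (1 / L - 1 / K) := by ring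
  rw [h8, abs_le]
  constructor <;> linarith

lemma mem_nearResonant_of_shell {N : ℕ} (hN : 1 ≤ N) {j y z : ℤ} {δ τ : ℝ}
    (hτ1 : τ ≤ 1) (hτ : τ ≤ δ * N) (hj : 0 ≤ j) (hz : 2 ≤ z)
    (hzD : (4 * N * j * z + 2 * z ^ 2 : ℝ) ≤ 2 * δ * N ^ 3)
    (hK : ((N + j) ^ 2 + y ^ 2 + z ^ 2 : ℝ) ≤ 4 * N ^ 2)
    (hL : (4 * N ^ 2 + 1 - τ * N ^ 2 : ℝ) ≤ (N - j) ^ 2 + y ^ 2 + (z - 1) ^ 2) :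
    ![N + j, y, z] ∈ nearResonant ![-2 * (N : ℤ), 0, -1] δ := by
  have hN' : (1 : ℝ) ≤ N := by exact_mod_cast hN
  have hj' : (0 : ℝ) ≤ j := by exact_mod_cast hj
  have hz' : (2 : ℝ) ≤ z := by exact_mod_cast hz
  set R := enorm3 ![-2 * (N : ℤ), 0, -1] with hR
  set K := enorm3 ![N + j, y, z] with hKdef
  set L := enorm3 (![-2 * (N : ℤ), 0, -1] + ![N + j, y, z]) with hLdef
  have R2 : R ^ 2 = 4 * N ^ 2 + 1 := by
    rw [hR, enorm3, Real.sq_sqrt (by positivity)]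
    simp
    ring
  have K2 : K ^ 2 = (N + j) ^ 2 + y ^ 2 + z ^ 2 := by
    rw [hKdef, enorm3, Real.sq_sqrt (by positivity)]
    simp
  have L2 : L ^ 2 = (N - j) ^ 2 + y ^ 2 + (z - 1) ^ 2 := by
    rw [hLdef, enorm3, Real.sq_sqrt (by positivity)]
    simp
    ring
  have R0 : 0 ≤ R := Real.sqrt_nonneg _
  have K0 : 0 ≤ K := Real.sqrt_nonneg _
  have L0 : 0 ≤ L := Real.sqrt_nonneg _
  have hNj : (0 : ℝ) ≤ N * j := by positivity
  have hτN : τ * (N : ℝ) ^ 2 ≤ 1 * (N : ℝ) ^ 2 := by gcongr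
  have hτN' : τ * (N : ℝ) ^ 2 ≤ δ * N * (N : ℝ) ^ 2 := by gcongr
  have hτN'' : 0 ≤ τ * (N : ℝ) ^ 2 := by nlinarith
  have hKR : K ≤ R := by
    apply le_of_sq_le_sq _ R0
    rw [K2, R2]; linarith
  have hLK : L ≤ K := by
    apply le_of_sq_le_sq _ K0
    rw [K2, L2]; nlinarith
  have hNL : (N : ℝ) ≤ L := by
    apply le_of_sq_le_sq _ L0
    rw [L2]; nlinarith
  refine ⟨?_, hKR, hLK, ?_, ?_⟩
  · simp
    constructor <;> omega
  · apply le_of_sq_le_sq _ L0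
    rw [div_pow, R2, L2]; nlinarith
  · have := abs_resonance_le (z := z) (δ := δ) (by linarith) hNL hLK hKR (by linarith)
      (by rw [K2, L2]; nlinarith) (by rw [R2, L2]; nlinarith)
    change |((-1 : ℤ) : ℝ) / R + (z : ℝ) / K - ((-1 + z : ℤ) : ℝ) / L| ≤ δ
    push_cast
    exact this

lemma card_mul_le_encard_nearResonant {N m : ℕ} (hN : 1 ≤ N) {δ τ : ℝ}
    (hτ1 : τ ≤ 1) (hτ : τ ≤ δ * N) (hm : (8 * m : ℝ) ≤ τ * N) (P : Finset (ℕ × ℕ))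
    (hP : ∀ p ∈ P, 2 ≤ p.2 ∧ p.2 ≤ N ∧ (16 * p.1 : ℝ) ≤ τ * N ∧ (8 * p.2 : ℝ) ≤ τ * N ^ 2 ∧
      (4 * N * p.1 * p.2 + 2 * p.2 ^ 2 : ℝ) ≤ 2 * δ * N ^ 3) :
    ((P.card * m : ℕ) : ℕ∞) ≤ (nearResonant ![-2 * (N : ℤ), 0, -1] δ).encard := by
  let u : ℕ × ℕ → ℝ := fun p ↦ 4 * N ^ 2 - (N + p.1) ^ 2 - p.2 ^ 2
  let F : (ℕ × ℕ) × ℕ → Fin 3 → ℤ := fun q ↦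
    ![N + (q.1.1 : ℤ), ⌊√(u q.1)⌋ - (q.2 : ℤ), (q.1.2 : ℤ)]
  have hF : Function.Injective F := by
    rintro ⟨⟨a, b⟩, i⟩ ⟨⟨a', b'⟩, i'⟩ h
    have h0 := congrFun h 0
    have h1 := congrFun h 1
    have h2 := congrFun h 2
    simp [F] at h0 h1 h2
    subst h0 h2
    simpa using h1
  have hsub : F '' (P ×ˢ Finset.range m : Finset _) ⊆ nearResonant ![-2 * (N : ℤ), 0, -1] δ := by
    rintro _ ⟨⟨⟨j, z⟩, i⟩, hq, rfl⟩
    simp only [Finset.coe_product, Set.mem_prod, Finset.mem_coe, Finset.mem_range] at hq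
    obtain ⟨hz2, hzN, hj, hz, hzD⟩ := hP _ hq.1
    have hi : (i : ℝ) + 1 ≤ m := by exact_mod_cast hq.2
    simp only at hz2 hzN hj hz hzD
    have hN' : (1 : ℝ) ≤ N := by exact_mod_cast hN
    have hzN' : (z : ℝ) ≤ N := by exact_mod_cast hzN
    have hz0 : (0 : ℝ) ≤ z := by positivity
    have hj0 : (0 : ℝ) ≤ j := by positivity
    have hτN : τ * N ≤ 1 * (N : ℝ) := by gcongr
    have hu : (N : ℝ) ^ 2 ≤ u (j, z) := by
      simp only [u]; nlinarith
    have hu' : u (j, z) ≤ (2 * N) ^ 2 := by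
      simp only [u]; nlinarith
    set s := √(u (j, z)) with hs
    have hs2 : s ^ 2 = u (j, z) := Real.sq_sqrt (by nlinarith)
    have hsN : (N : ℝ) ≤ s := Real.le_sqrt_of_sq_le hu
    have hsN' : s ≤ 2 * N := Real.sqrt_le_iff.2 ⟨by positivity, hu'⟩
    have hfl := Int.floor_le s
    have hfl' := Int.lt_floor_add_one s
    have hy1 : (((⌊s⌋ - i : ℤ)) : ℝ) ≤ s := by
      push_cast; linarith [Nat.cast_nonneg (α := ℝ) i]
    have hy2 : s - m ≤ (((⌊s⌋ - i : ℤ)) : ℝ) := by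
      push_cast; linarith
    have hsm : 0 ≤ s - m := by linarith
    have hy3 : (((⌊s⌋ - i : ℤ)) : ℝ) ^ 2 ≤ s ^ 2 := by
      gcongr
      linarith
    have hy4 : (s - m) ^ 2 ≤ (((⌊s⌋ - i : ℤ)) : ℝ) ^ 2 := by gcongr
    have hsm' : s * m ≤ (2 * N) * m := by gcongr
    have hmN : (8 * m : ℝ) * N ≤ τ * N * N := by gcongr
    have hjN : (16 * j : ℝ) * N ≤ τ * N * N := by gcongr
    simp only [u] at hs2
    refine mem_nearResonant_of_shell hN hτ1 hτ (by positivity) (by exact_mod_cast hz2)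
      (by exact_mod_cast hzD) ?_ ?_
    · simp only [Int.cast_natCast]
      linarith
    · simp only [Int.cast_natCast]
      nlinarith
  have h := Set.encard_le_encard hsub
  rwa [hF.encard_image, Set.encard_coe_eq_coe_finsetCard, Finset.card_product,
    Finset.card_range] at h

/-- A real lower bound for the cardinality of the near-resonant set. -/
def CountAtLeast (N : ℕ) (δ x : ℝ) : Prop :=
  ENNReal.ofReal x ≤ ((nearResonant ![-2 * (N : ℤ), 0, -1] δ).encard : ℝ≥0∞)

lemma CountAtLeast.mono {N : ℕ} {δ x y : ℝ} (h : CountAtLeast N δ x) (hy : y ≤ x) :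
    CountAtLeast N δ y :=
  (ENNReal.ofReal_le_ofReal hy).trans h

lemma countAtLeast_card_mul {N : ℕ} (hN : 1 ≤ N) {δ τ : ℝ}
    (hτ1 : τ ≤ 1) (hτ : τ ≤ δ * N) (hτN : 16 ≤ τ * N) (P : Finset (ℕ × ℕ))
    (hP : ∀ p ∈ P, 2 ≤ p.2 ∧ p.2 ≤ N ∧ (16 * p.1 : ℝ) ≤ τ * N ∧
      (4 * N * p.1 * p.2 + 2 * p.2 ^ 2 : ℝ) ≤ 2 * δ * N ^ 3) :
    CountAtLeast N δ (P.card * (τ * N / 16)) := by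
  have hm : ((⌊τ * N / 8⌋₊ : ℕ) : ℝ) ≤ τ * N / 8 := Nat.floor_le (by linarith)
  have hm' := Nat.lt_floor_add_one (τ * N / 8)
  have h := card_mul_le_encard_nearResonant (m := ⌊τ * N / 8⌋₊) hN hτ1 hτ (by linarith) P
    fun p hp ↦ by
      obtain ⟨h1, h2, h3, h4⟩ := hP p hp
      have h5 : (p.2 : ℝ) ≤ N := by exact_mod_cast h2
      exact ⟨h1, h2, h3, by nlinarith [Nat.cast_nonneg (α := ℝ) N], h4⟩
  have h' : (((P.card * ⌊τ * N / 8⌋₊ : ℕ) : ℕ∞) : ℝ≥0∞) ≤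
      ((nearResonant ![-2 * (N : ℤ), 0, -1] δ).encard : ℝ≥0∞) := by exact_mod_cast h
  refine le_trans ?_ h'
  rw [ENat.toENNReal_coe, ← ENNReal.ofReal_natCast]
  apply ENNReal.ofReal_le_ofReal
  push_cast
  gcongr
  linarith

lemma log_le_sum_one_div {a b : ℕ} (ha : 1 ≤ a) (hab : a ≤ b + 1) :
    Real.log ((b + 1) / a) ≤ ∑ j ∈ Finset.Icc a b, (1 / j : ℝ) := by
  have ha' : (0 : ℝ) < a := by exact_mod_cast ha
  induction b, (show a - 1 ≤ b by omega) using Nat.le_induction with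
  | base =>
    rw [Finset.Icc_eq_empty (by omega)]
    have : ((a - 1 : ℕ) : ℝ) + 1 = a := by
      rw [Nat.cast_sub ha]; simp
    simp [this, ha'.ne']
  | succ b hb ih =>
    rw [Finset.sum_Icc_succ_top (by omega)]
    have hb' : (0 : ℝ) < (b + 1 : ℕ) := by positivity
    have h1 := Real.log_le_sub_one_of_pos (x := ((b + 1 : ℕ) + 1 : ℝ) / (b + 1 : ℕ))
      (by positivity)
    have h2 : (((b + 1 : ℕ) : ℝ) + 1) / a =
        (((b + 1 : ℕ) + 1 : ℝ) / (b + 1 : ℕ)) * ((b + 1) / a) := by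
      push_cast
      field_simp
    rw [h2, Real.log_mul (by positivity) (by positivity)]
    have h3 : (((b + 1 : ℕ) : ℝ) + 1) / (b + 1 : ℕ) - 1 = 1 / (b + 1 : ℕ) := by
      field_simp
      ring
    have := ih (by omega)
    linarith

/-- The lattice points `(j, z)` with `a ≤ j ≤ b` and `2 ≤ z ≤ M / j`. -/
noncomputable def hyperbolaPairs (a b : ℕ) (M : ℝ) : Finset (ℕ × ℕ) :=
  (Finset.Icc a b).biUnion fun j ↦ (Finset.Icc 2 ⌊M / j⌋₊).image fun z ↦ (j, z)

lemma mem_hyperbolaPairs {a b : ℕ} {M : ℝ} {p : ℕ × ℕ} (ha : 1 ≤ a) (hM : 0 ≤ M) :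
    p ∈ hyperbolaPairs a b M ↔ (a ≤ p.1 ∧ p.1 ≤ b) ∧ 2 ≤ p.2 ∧ (p.1 * p.2 : ℝ) ≤ M := by
  obtain ⟨j, z⟩ := p
  simp only [hyperbolaPairs, Finset.mem_biUnion, Finset.mem_image, Finset.mem_Icc, Prod.mk.injEq]
  have key (h : a ≤ j) : z ≤ ⌊M / j⌋₊ ↔ (j * z : ℝ) ≤ M := by
    have : (0 : ℝ) < j := by exact_mod_cast ha.trans h
    rw [Nat.le_floor_iff (by positivity), le_div_iff₀ this, mul_comm]
  constructor
  · rintro ⟨_, hj, _, hz, rfl, rfl⟩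
    exact ⟨hj, hz.1, (key hj.1).1 hz.2⟩
  · rintro ⟨hj, hz, hjz⟩
    exact ⟨j, hj, z, ⟨hz, (key hj.1).2 hjz⟩, rfl, rfl⟩

lemma le_card_hyperbolaPairs {a b : ℕ} {M : ℝ} (ha : 1 ≤ a) (hab : a ≤ b + 1)
    (hb : (4 * b : ℝ) ≤ M) :
    M / 2 * Real.log ((b + 1) / a) ≤ (hyperbolaPairs a b M).card := by
  have hM : 0 ≤ M := le_trans (by positivity) hb
  rw [hyperbolaPairs, Finset.card_biUnion]
  · push_cast
    refine (mul_le_mul_of_nonneg_left (log_le_sum_one_div ha hab) (by positivity)).trans ?_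
    rw [Finset.mul_sum]
    refine Finset.sum_le_sum fun j hj ↦ ?_
    rw [Finset.mem_Icc] at hj
    have hj0 : (0 : ℝ) < j := by exact_mod_cast ha.trans hj.1
    have hjb : (j : ℝ) ≤ b := by exact_mod_cast hj.2
    rw [Finset.card_image_of_injective _ (fun x y h ↦ by simpa using h), Nat.card_Icc]
    have h4 : 4 ≤ M / j := by
      rw [le_div_iff₀ hj0]; linarith
    have hfl := Nat.lt_floor_add_one (M / j)
    have h2 : 2 ≤ ⌊M / j⌋₊ := Nat.le_floor (by push_cast; linarith)
    rw [Nat.cast_sub (by omega)]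
    push_cast
    have : M / 2 * (1 / j) = M / j / 2 := by ring
    linarith
  · intro i _ j _ hij
    rw [Function.onFun, Finset.disjoint_left]
    simp only [Finset.mem_image, not_exists, not_and]
    rintro _ ⟨_, _, rfl⟩ z _ h
    exact hij (congrArg Prod.fst h).symm

lemma countAtLeast_sqrt_pow {N : ℕ} (hN : 4 ≤ N) {δ τ : ℝ}
    (hτ1 : τ ≤ 1) (hτ : τ ≤ δ * N) (hτN : 16 ≤ τ * N) :
    CountAtLeast N δ (√τ ^ 3 * N ^ 2 / 64) := by
  have hN' : (4 : ℝ) ≤ N := by exact_mod_cast hN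
  have hτ0 : 0 ≤ τ := by
    by_contra! h
    nlinarith
  set q := √τ with hq
  have hq0 : 0 ≤ q := Real.sqrt_nonneg _
  have hq2 : q ^ 2 = τ := Real.sq_sqrt hτ0
  have hq1 : q ≤ 1 := by nlinarith
  have hqN : 8 ≤ q * N := by
    apply le_of_sq_le_sq _ (by positivity)
    rw [mul_pow, hq2]
    nlinarith
  have hfl : ((⌊q * N / 2⌋₊ : ℕ) : ℝ) ≤ q * N / 2 := Nat.floor_le (by positivity)
  have hfl' := Nat.lt_floor_add_one (q * N / 2)
  have h2 : 2 ≤ ⌊q * N / 2⌋₊ := Nat.le_floor (by push_cast; linarith)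
  refine (countAtLeast_card_mul (by omega) hτ1 hτ hτN ({0} ×ˢ Finset.Icc 2 ⌊q * N / 2⌋₊)
    ?_).mono ?_
  · rintro ⟨j, z⟩ hp
    simp only [Finset.mem_product, Finset.mem_singleton, Finset.mem_Icc] at hp
    obtain ⟨rfl, hz2, hz⟩ := hp
    have hz' : (z : ℝ) ≤ q * N / 2 := le_trans (by exact_mod_cast hz) hfl
    have hzN : (z : ℝ) ≤ N := by nlinarith
    have hzz : (z : ℝ) ^ 2 ≤ (q * N / 2) ^ 2 := by gcongr
    have hτ3 : τ * (N : ℝ) ^ 2 ≤ δ * N * (N : ℝ) ^ 2 := by gcongr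
    have hsq : (q * N / 2) ^ 2 = τ * N ^ 2 / 4 := by rw [← hq2]; ring
    refine ⟨hz2, by exact_mod_cast hzN, by simpa using by linarith, ?_⟩
    have : 0 ≤ τ * (N : ℝ) ^ 2 := by positivity
    simp only [Nat.cast_zero, mul_zero, zero_mul, zero_add]
    nlinarith
  · rw [Finset.card_product, Finset.card_singleton, Nat.card_Icc, one_mul,
      Nat.cast_sub (by omega)]
    push_cast
    calc q ^ 3 * N ^ 2 / 64 = (q * N / 4) * (τ * N / 16) := by rw [← hq2]; ring
      _ ≤ _ := by
        gcongr
        linarith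

lemma countAtLeast_log {N : ℕ} (hN : 1 ≤ N) {δ τ : ℝ} (hδ : 0 < δ)
    (hτ1 : τ ≤ 1) (hτ : τ ≤ δ * N) (hτN : 16 ≤ τ * N) {a b : ℕ} (ha : 1 ≤ a) (hab : a ≤ b + 1)
    (hbM : (128 * b : ℝ) ≤ δ * N ^ 2) (hbτ : (16 * b : ℝ) ≤ τ * N) (haM : δ * N ≤ 32 * a) :
    CountAtLeast N δ (δ * N ^ 2 / 64 * Real.log ((b + 1) / a) * (τ * N / 16)) := by
  have hN0 : (1 : ℝ) ≤ N := by exact_mod_cast hN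
  have ha0 : (1 : ℝ) ≤ a := by exact_mod_cast ha
  refine (countAtLeast_card_mul hN hτ1 hτ hτN (hyperbolaPairs a b (δ * N ^ 2 / 32)) ?_).mono ?_
  · rintro ⟨j, z⟩ hp
    rw [mem_hyperbolaPairs ha (by positivity)] at hp
    obtain ⟨⟨haj, hjb⟩, hz2, hjz⟩ := hp
    simp only at haj hjb hz2 hjz ⊢
    have haj' : (a : ℝ) ≤ j := by exact_mod_cast haj
    have hjb' : (j : ℝ) ≤ b := by exact_mod_cast hjb
    have hz0 : (0 : ℝ) ≤ z := by positivity
    have haz : (a * z : ℝ) ≤ j * z := by gcongr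
    have h1 : δ * N * N ≤ 32 * a * N := by gcongr
    have hzN : (z : ℝ) ≤ N := by
      have : (a : ℝ) * z ≤ a * N := by linarith
      exact le_of_mul_le_mul_left this (by linarith)
    have h1z : (z : ℝ) ≤ δ * N ^ 2 / 32 := by nlinarith
    have hzz : (z : ℝ) * z ≤ δ * N ^ 2 / 32 * N := by gcongr
    have hjzN : (j * z : ℝ) * N ≤ δ * N ^ 2 / 32 * N := by gcongr
    refine ⟨hz2, by exact_mod_cast hzN, by linarith, ?_⟩
    have : 0 ≤ δ * (N : ℝ) ^ 3 := by positivity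
    linarith
  · gcongr
    calc _ = δ * N ^ 2 / 32 / 2 * Real.log ((b + 1) / a) := by ring
      _ ≤ _ := le_card_hyperbolaPairs ha hab (by linarith)

lemma CountAtLeast.add_half {N : ℕ} {δ x y : ℝ} (hx : CountAtLeast N δ x)
    (hy : CountAtLeast N δ y) : CountAtLeast N δ ((x + y) / 2) := by
  rcases le_total x y with h | h
  · exact hy.mono (by linarith)
  · exact hx.mono (by linarith)

lemma min_rpow_le {x τ : ℝ} (hx : 0 ≤ x) (hτ : 0 ≤ τ) (h : τ = 1 ∨ x ≤ 4 * τ) :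
    min 1 (x ^ ((3 : ℝ) / 2)) ≤ 8 * √τ ^ 3 := by
  rcases h with rfl | h
  · refine (min_le_left _ _).trans ?_
    norm_num
  · refine (min_le_right _ _).trans ?_
    have h1 : 4 * τ = (2 * √τ) ^ (2 : ℝ) := by
      rw [Real.rpow_two, mul_pow, Real.sq_sqrt hτ]
      ring
    calc x ^ ((3 : ℝ) / 2) ≤ (4 * τ) ^ ((3 : ℝ) / 2) := by gcongr
      _ = (2 * √τ) ^ (3 : ℕ) := by
        rw [h1, ← Real.rpow_mul (by positivity), ← Real.rpow_natCast]
        norm_num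
      _ = 8 * √τ ^ 3 := by ring

lemma sqrt_mul_log_le {N τ : ℝ} (hN : 1 ≤ N) (h : τ ^ 2 * N ≤ 1) :
    √τ * Real.log N ≤ 4 := by
  set r := √(√N) with hr
  have hr4 : r ^ 4 = N := by
    rw [show r ^ 4 = (r ^ 2) ^ 2 by ring, Real.sq_sqrt (by positivity), Real.sq_sqrt (by linarith)]
  have hr0 : 0 < r := by positivity
  have hlog : Real.log N ≤ 4 * r := by
    rw [← hr4, Real.log_pow]
    have := Real.log_le_sub_one_of_pos hr0
    push_cast
    linarith
  rcases le_total τ 0 with hτ | hτ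
  · simp [Real.sqrt_eq_zero_of_nonpos hτ]
  have hq0 : 0 ≤ √τ := Real.sqrt_nonneg _
  have hq : √τ * r ≤ 1 := by
    rw [← pow_le_one_iff_of_nonneg (by positivity) (n := 4) (by norm_num), mul_pow, hr4,
      show √τ ^ 4 = (√τ ^ 2) ^ 2 by ring, Real.sq_sqrt hτ]
    exact h
  calc √τ * Real.log N ≤ √τ * (4 * r) := by gcongr
    _ ≤ 4 := by linarith

lemma quarter_log_le_log_div {N τ : ℝ} (hN : 2 ^ 28 ≤ N) (hτ : 0 ≤ τ) (h : 1 ≤ τ ^ 2 * N) :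
    Real.log N / 4 ≤ Real.log (τ * N / 128) := by
  have hN0 : 0 < N := by linarith
  have hτ0 : 0 < τ := by
    rcases hτ.eq_or_lt with rfl | h'
    · norm_num at h
    · exact h'
  have key : N ≤ (τ * N / 128) ^ 4 := by
    have h1 : 1 ≤ (τ ^ 2 * N) ^ 2 := one_le_pow₀ h
    calc N ≤ N * (N / 2 ^ 28) * 1 := by
          rw [mul_one]
          exact le_mul_of_one_le_right hN0.le ((one_le_div (by norm_num)).2 hN)
      _ ≤ N * (N / 2 ^ 28) * (τ ^ 2 * N) ^ 2 := by gcongr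
      _ = (τ * N / 128) ^ 4 := by ring
  have := Real.log_le_log hN0 key
  rw [Real.log_pow] at this
  push_cast at this
  linarith

lemma countAtLeast_log_main {N : ℕ} (hN : 2 ^ 28 ≤ N) {δ τ R : ℝ} (hδ : 0 < δ) (hδ1 : δ < 1 / 2)
    (hτ1 : τ ≤ 1) (hτ : τ ≤ δ * N) (hτN : 16 ≤ τ * N) (h : τ = 1 ∨ τ = δ * N)
    (hR : N ≤ R) (hR3 : R ≤ 3 * N) :
    CountAtLeast N δ
      (1 / 10 ^ 6 * (R ^ 3 * δ * min (Real.log (1 / δ)) (δ * R * Real.log R))) := by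
  have hN' : (2 ^ 28 : ℝ) ≤ N := by exact_mod_cast hN
  have hN0 : (0 : ℝ) < N := by linarith
  have hR0 : 0 < R := by linarith
  have hτ0 : 0 < τ := by
    by_contra! h'
    nlinarith
  have hlogN : 0 ≤ Real.log N := Real.log_nonneg (by linarith)
  have hlogδ : 0 ≤ Real.log (1 / δ) := Real.log_nonneg (by rw [le_div_iff₀ hδ]; linarith)
  have hlogR : Real.log R ≤ 2 * Real.log N := by
    have := Real.log_le_log (by linarith) (show R ≤ (N : ℝ) ^ 2 by nlinarith)
    rw [Real.log_pow] at this
    exact_mod_cast this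
  have hlogR0 : 0 ≤ Real.log R := Real.log_nonneg (by linarith)
  have hmin0 : 0 ≤ min (Real.log (1 / δ)) (δ * R * Real.log R) :=
    le_min hlogδ (by positivity)
  have hR27 : R ^ 3 * δ * min (Real.log (1 / δ)) (δ * R * Real.log R) ≤
      27 * N ^ 3 * δ * min (Real.log (1 / δ)) (δ * R * Real.log R) := by
    have : R ^ 3 ≤ (3 * N) ^ 3 := by gcongr
    gcongr
    linarith
  by_cases h32 : 32 ≤ δ * N
  · obtain rfl : τ = 1 := by
      rcases h with h | h
      · exact h
      · linarith
    have ha := Nat.le_ceil (δ * N / 32)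
    have ha' := Nat.ceil_lt_add_one (show 0 ≤ δ * N / 32 by positivity)
    have hb : ((⌊(N : ℝ) / 16⌋₊ : ℕ) : ℝ) ≤ N / 16 := Nat.floor_le (by positivity)
    have hb' := Nat.lt_floor_add_one ((N : ℝ) / 16)
    have ha1 : 1 ≤ ⌈δ * N / 32⌉₊ := Nat.one_le_ceil_iff.2 (by positivity)
    have ha0 : (0 : ℝ) < ⌈δ * N / 32⌉₊ := by exact_mod_cast ha1
    refine (countAtLeast_log (by omega) hδ le_rfl hτ hτN (a := ⌈δ * N / 32⌉₊)
      (b := ⌊(N : ℝ) / 16⌋₊) ha1 ?_ ?_ ?_ ?_).mono ?_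
    · have : (⌈δ * N / 32⌉₊ : ℝ) ≤ ⌊(N : ℝ) / 16⌋₊ + 1 := by nlinarith
      exact_mod_cast this
    · nlinarith
    · linarith
    · linarith
    · have hlog : Real.log (1 / δ) ≤ Real.log ((⌊(N : ℝ) / 16⌋₊ + 1) / ⌈δ * N / 32⌉₊) := by
        apply Real.log_le_log (by positivity)
        rw [div_le_div_iff₀ hδ ha0]
        nlinarith
      calc 1 / 10 ^ 6 * (R ^ 3 * δ * min (Real.log (1 / δ)) (δ * R * Real.log R))
          ≤ 1 / 10 ^ 6 * (27 * N ^ 3 * δ * Real.log (1 / δ)) := by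
            refine mul_le_mul_of_nonneg_left (hR27.trans ?_) (by norm_num)
            gcongr
            exact min_le_left _ _
        _ ≤ δ * N ^ 2 / 64 * Real.log (1 / δ) * (1 * N / 16) := by
            have : 0 ≤ (N : ℝ) ^ 3 * δ * Real.log (1 / δ) := by positivity
            linarith
        _ ≤ _ := by gcongr
  push Not at h32
  have hmin : min (Real.log (1 / δ)) (δ * R * Real.log R) ≤ 6 * (τ * Real.log N) := by
    rcases h with rfl | h
    · refine (min_le_left _ _).trans ?_
      have : Real.log (1 / δ) ≤ Real.log N := by
        apply Real.log_le_log (by positivity)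
        rw [div_le_iff₀ hδ]
        linarith
      linarith
    · refine (min_le_right _ _).trans ?_
      calc δ * R * Real.log R ≤ δ * (3 * N) * (2 * Real.log N) := by gcongr
        _ = 6 * (τ * Real.log N) := by rw [h]; ring
  have hR162 : R ^ 3 * δ * min (Real.log (1 / δ)) (δ * R * Real.log R) ≤
      162 * N ^ 3 * δ * (τ * Real.log N) := by
    refine hR27.trans ?_
    calc _ ≤ 27 * N ^ 3 * δ * (6 * (τ * Real.log N)) := by gcongr
      _ = _ := by ring
  rcases le_total 1 (τ ^ 2 * N) with hbig | hsmall
  · have hb : ((⌊τ * N / 128⌋₊ : ℕ) : ℝ) ≤ τ * N / 128 := Nat.floor_le (by positivity)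
    have hb' := Nat.lt_floor_add_one (τ * N / 128)
    have hτN2 : τ * N ≤ δ * N * N := by gcongr
    refine (countAtLeast_log (by omega) hδ hτ1 hτ hτN (a := 1) (b := ⌊τ * N / 128⌋₊)
      le_rfl (by omega) (by linarith) (by linarith) (by push_cast; linarith)).mono ?_
    have hlog : Real.log N / 4 ≤ Real.log ((⌊τ * N / 128⌋₊ + 1) / (1 : ℕ)) := by
      refine (quarter_log_le_log_div hN' hτ0.le hbig).trans ?_
      apply Real.log_le_log (by positivity)
      rw [Nat.cast_one, div_one]
      exact hb'.le
    calc 1 / 10 ^ 6 * (R ^ 3 * δ * min (Real.log (1 / δ)) (δ * R * Real.log R))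
        ≤ 1 / 10 ^ 6 * (162 * N ^ 3 * δ * (τ * Real.log N)) := by gcongr
      _ ≤ δ * N ^ 2 / 64 * (Real.log N / 4) * (τ * N / 16) := by
          have : 0 ≤ (N : ℝ) ^ 3 * δ * (τ * Real.log N) := by positivity
          linarith
      _ ≤ _ := by gcongr
  · have hτδ : τ = δ * N := by
      rcases h with rfl | h
      · linarith
      · exact h
    refine (countAtLeast_sqrt_pow (by omega) hτ1 hτ hτN).mono ?_
    have hq : √τ * Real.log N ≤ 4 := sqrt_mul_log_le (by linarith) hsmall
    have hq2 : √τ ^ 2 = τ := Real.sq_sqrt hτ0.le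
    calc 1 / 10 ^ 6 * (R ^ 3 * δ * min (Real.log (1 / δ)) (δ * R * Real.log R))
        ≤ 1 / 10 ^ 6 * (162 * N ^ 3 * δ * (τ * Real.log N)) := by gcongr
      _ = 162 / 10 ^ 6 * N ^ 2 * (δ * N) * τ * Real.log N := by ring
      _ = 162 / 10 ^ 6 * N ^ 2 * (√τ ^ 3 * (√τ * Real.log N)) := by
          rw [← hτδ]
          nth_rw 1 2 [← hq2]
          ring
      _ ≤ 162 / 10 ^ 6 * N ^ 2 * (√τ ^ 3 * 4) := by gcongr
      _ ≤ √τ ^ 3 * N ^ 2 / 64 := by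
          have : 0 ≤ √τ ^ 3 * (N : ℝ) ^ 2 := by positivity
          linarith

theorem stmt18 :
    ∃ c : ℝ, 0 < c ∧ ∃ C₀ : ℝ, 0 < C₀ ∧ ∃ N₀ : ℕ, 0 < N₀ ∧
    ∀ N : ℕ, N₀ ≤ N →
    ∀ n : Fin 3 → ℤ, n = ![-2 * (N : ℤ), 0, -1] →
    ∀ δ : ℝ, 0 < δ → δ < 1 / 2 → C₀ ≤ δ * enorm3 n ^ 2 →
    ENNReal.ofReal (c * (enorm3 n ^ 2 * min 1 ((δ * enorm3 n) ^ ((3 : ℝ) / 2)) +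
        enorm3 n ^ 3 * δ * min (Real.log (1 / δ)) (δ * enorm3 n * Real.log (enorm3 n))))
      ≤ (({k : Fin 3 → ℤ | (n 2) * (k 2) * (n 2 + k 2) ≠ 0 ∧
            enorm3 k ≤ enorm3 n ∧ enorm3 (n + k) ≤ enorm3 k ∧
            enorm3 n / 3 ≤ enorm3 (n + k) ∧
            |(n 2 : ℝ) / enorm3 n + (k 2 : ℝ) / enorm3 k -
              ((n 2 + k 2 : ℤ) : ℝ) / enorm3 (n + k)| ≤ δ}.encard : ℕ∞) : ℝ≥0∞) := by
  refine ⟨1 / 10 ^ 7, by norm_num, 80, by norm_num, 2 ^ 28, by norm_num, ?_⟩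
  rintro N hN _ rfl δ hδ hδ1 hC
  change CountAtLeast N δ _
  have hN' : (2 ^ 28 : ℝ) ≤ N := by exact_mod_cast hN
  set R := enorm3 ![-2 * (N : ℤ), 0, -1] with hRdef
  have hR0 : 0 ≤ R := Real.sqrt_nonneg _
  have hR2 : R ^ 2 = 4 * N ^ 2 + 1 := by
    rw [hRdef, enorm3, Real.sq_sqrt (by positivity)]
    simp
    ring
  have hR : N ≤ R := by
    apply le_of_sq_le_sq _ hR0
    nlinarith
  have hR3 : R ≤ 3 * N := by
    apply le_of_sq_le_sq _ (by positivity)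
    nlinarith
  have hδN : 16 ≤ δ * N * N := by
    have : δ * R ^ 2 ≤ δ * (5 * N ^ 2) := by
      rw [hR2]
      gcongr
      nlinarith
    linarith
  set τ := min 1 (δ * N) with hτdef
  have hτ0 : 0 ≤ τ := le_min zero_le_one (by positivity)
  have hτ1 : τ ≤ 1 := min_le_left _ _
  have hτ : τ ≤ δ * N := min_le_right _ _
  have hor : τ = 1 ∨ τ = δ * N := min_choice _ _
  have hτN : 16 ≤ τ * N := by
    rcases hor with h | h <;> rw [h]
    · linarith
    · exact hδN
  have hmin := min_rpow_le (x := δ * R) (by positivity) hτ0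
    (hor.imp_right fun h ↦ by rw [h]; nlinarith)
  have h1 : CountAtLeast N δ (1 / 10 ^ 6 * (R ^ 2 * min 1 ((δ * R) ^ ((3 : ℝ) / 2)))) := by
    refine (countAtLeast_sqrt_pow (by omega) hτ1 hτ hτN).mono ?_
    calc 1 / 10 ^ 6 * (R ^ 2 * min 1 ((δ * R) ^ ((3 : ℝ) / 2)))
        ≤ 1 / 10 ^ 6 * ((3 * N) ^ 2 * (8 * √τ ^ 3)) := by gcongr
      _ ≤ √τ ^ 3 * N ^ 2 / 64 := by
          have : 0 ≤ √τ ^ 3 * (N : ℝ) ^ 2 := by positivity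
          linarith
  have h2 := countAtLeast_log_main hN hδ hδ1 hτ1 hτ hτN hor hR hR3
  refine (h1.add_half h2).mono ?_
  have hA : 0 ≤ R ^ 2 * min 1 ((δ * R) ^ ((3 : ℝ) / 2)) := by positivity
  have hB : 0 ≤ R ^ 3 * δ * min (Real.log (1 / δ)) (δ * R * Real.log R) := by
    have hlogδ : 0 ≤ Real.log (1 / δ) := Real.log_nonneg (by rw [le_div_iff₀ hδ]; linarith)
    have hlogR : 0 ≤ Real.log R := Real.log_nonneg (by linarith)
    have : 0 ≤ min (Real.log (1 / δ)) (δ * R * Real.log R) := le_min hlogδ (by positivity)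
    positivity
  linarith
end

section
/- For every real γ > 0 there is a constant C_γ (depending on γ, L₁, L₂), and for every real β ∈ (0, 3/2) there is a constant C_β (depending on β, L₁, L₂), such that for all sequences f, g, h : ℤ³ → ℂ with f₀ = g₀ = h₀ = 0 and every subset G ⊂ (ℤ³\{0})³: Σ_{n,k ∈ ℤ³} |f_n| |g_k| |h_{−n−k}| · 1_G(n, k, −n−k) ≤ C_γ ‖f‖_{3/2+γ} ‖g‖₀ ‖h‖₀, and also Σ_{n,k ∈ ℤ³} |f_n| |g_k| |h_{−n−k}| · 1_G(n, k, −n−k) ≤ C_β ‖f‖_{3/2−β} ‖g‖_β ‖h‖₀. -/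
open scoped BigOperators ENNReal

/-- Domain-adjusted wavevector `ň = (n₁/L₁, n₂/L₂, n₃)`. -/
noncomputable def cvec (L₁ L₂ : ℝ) (n : Fin 3 → ℤ) : Fin 3 → ℝ :=
  ![(n 0 : ℝ) / L₁, (n 1 : ℝ) / L₂, (n 2 : ℝ)]

/-- Euclidean norm `|ň|` of the domain-adjusted wavevector. -/
noncomputable def cnorm (L₁ L₂ : ℝ) (n : Fin 3 → ℤ) : ℝ :=
  Real.sqrt (cvec L₁ L₂ n 0 ^ 2 + cvec L₁ L₂ n 1 ^ 2 + cvec L₁ L₂ n 2 ^ 2)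

/-- Homogeneous Sobolev norm `‖u‖ₛ`, valued in `ℝ≥0∞` so that no summability assumption
is needed. -/
noncomputable def ehnorm (L₁ L₂ s : ℝ) (u : (Fin 3 → ℤ) → ℂ) : ℝ≥0∞ :=
  (∑' n : Fin 3 → ℤ, ENNReal.ofReal (cnorm L₁ L₂ n ^ (2 * s) * ‖u n‖ ^ 2)) ^ (1 / 2 : ℝ)

/-- The restricted convolution sum `Σ_{n,k} |f_n| |g_k| |h_{-n-k}| 1_G(n,k,-n-k)`. -/
noncomputable def convSum (G : Set ((Fin 3 → ℤ) × (Fin 3 → ℤ) × (Fin 3 → ℤ)))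
    (f g h : (Fin 3 → ℤ) → ℂ) : ℝ≥0∞ :=
  ∑' p : (Fin 3 → ℤ) × (Fin 3 → ℤ),
    ENNReal.ofReal (‖f p.1‖ * ‖g p.2‖ * ‖h (-p.1 - p.2)‖ *
      Set.indicator G (fun _ => (1 : ℝ)) (p.1, p.2, -p.1 - p.2))

lemma exists_one_le_abs_of_ne_zero {n : Fin 3 → ℤ} (hn : n ≠ 0) : ∃ i, (1 : ℝ) ≤ |(n i : ℝ)| := by
  obtain ⟨i, hi⟩ := Function.ne_iff.mp hn
  exact ⟨i, by exact_mod_cast Int.one_le_abs hi⟩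

lemma cnorm_nonneg (L₁ L₂ : ℝ) (n : Fin 3 → ℤ) : 0 ≤ cnorm L₁ L₂ n := Real.sqrt_nonneg _

/-- The norm `|ň|` dominates the moduli of the coordinates of `n`, and is bounded below off `0`. -/
lemma exists_mul_max_le_cnorm {L₁ L₂ : ℝ} (hL₁ : 0 < L₁) (hL₂ : 0 < L₂) :
    ∃ c : ℝ, 0 < c ∧ ∀ n : Fin 3 → ℤ, n ≠ 0 → ∀ i,
      c * max 1 ((n i).natAbs : ℝ) ≤ cnorm L₁ L₂ n := by
  refine ⟨min 1 (min L₁⁻¹ L₂⁻¹), by positivity, fun n hn i => ?_⟩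
  set c := min 1 (min L₁⁻¹ L₂⁻¹) with hc
  have hc0 : 0 < c := by positivity
  have h1 : c ≤ 1 := min_le_left _ _
  have h2 : c ≤ L₁⁻¹ := (min_le_right _ _).trans (min_le_left _ _)
  have h3 : c ≤ L₂⁻¹ := (min_le_right _ _).trans (min_le_right _ _)
  have hcoord : ∀ j, c * |(n j : ℝ)| ≤ |cvec L₁ L₂ n j| := by
    intro j
    fin_cases j
    · change c * |(n 0 : ℝ)| ≤ |(n 0 : ℝ) / L₁|
      rw [abs_div, abs_of_pos hL₁, div_eq_mul_inv, mul_comm]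
      gcongr
    · change c * |(n 1 : ℝ)| ≤ |(n 1 : ℝ) / L₂|
      rw [abs_div, abs_of_pos hL₂, div_eq_mul_inv, mul_comm]
      gcongr
    · simpa [cvec] using mul_le_of_le_one_left (abs_nonneg (n 2 : ℝ)) h1
  have hle : ∀ j, |cvec L₁ L₂ n j| ≤ cnorm L₁ L₂ n := by
    intro j
    refine Real.abs_le_sqrt ?_
    fin_cases j <;> simp only [Fin.zero_eta, Fin.mk_one, Fin.reduceFinMk] <;>
      linarith [sq_nonneg (cvec L₁ L₂ n 0), sq_nonneg (cvec L₁ L₂ n 1),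
        sq_nonneg (cvec L₁ L₂ n 2)]
  obtain ⟨j, hj⟩ := exists_one_le_abs_of_ne_zero hn
  rw [mul_max_of_nonneg _ _ hc0.le, Nat.cast_natAbs, Int.cast_abs]
  refine max_le ?_ ((hcoord i).trans (hle i))
  exact (mul_le_mul_of_nonneg_left hj hc0.le).trans ((hcoord j).trans (hle j))

lemma sum_range_max_rpow_le {a : ℝ} (ha : 0 < a) (ha1 : a ≤ 1) (N : ℕ) :
    ∑ m ∈ Finset.range (N + 1), (max 1 (m : ℝ)) ^ (a - 1) ≤ 1 + (N : ℝ) ^ a / a := by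
  induction N with
  | zero => simp [Real.zero_rpow ha.ne']
  | succ N ih =>
    rw [Finset.sum_range_succ]
    have hx : (0 : ℝ) < N + 1 := by positivity
    have hmax : max 1 ((N + 1 : ℕ) : ℝ) = N + 1 := by push_cast; simp
    have hb := rpow_one_add_le_one_add_mul_self (s := -1 / ((N : ℝ) + 1))
      (by rw [le_div_iff₀ hx]; linarith [(Nat.cast_nonneg N : (0 : ℝ) ≤ N)]) ha.le ha1
    have he : 1 + -1 / ((N : ℝ) + 1) = N / (N + 1) := by field_simp; ring
    rw [he, Real.div_rpow (Nat.cast_nonneg N) hx.le, div_le_iff₀ (by positivity)] at hb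
    rw [hmax, Real.rpow_sub_one hx.ne']
    have : ((N : ℝ) + 1) ^ a / (N + 1) ≤ ((N : ℝ) + 1) ^ a / a - (N : ℝ) ^ a / a := by
      rw [← sub_div, le_div_iff₀ ha]
      have e : (1 + a * (-1 / ((N : ℝ) + 1))) * ((N : ℝ) + 1) ^ a
        = ((N : ℝ) + 1) ^ a - ((N : ℝ) + 1) ^ a / (N + 1) * a := by field_simp; ring
      linarith
    push_cast
    linarith

open Classical in
lemma tsum_ite_le_max_rpow_le {a : ℝ} (ha : 0 < a) (ha1 : a ≤ 1) {X : ℝ} (hX : 1 ≤ X) :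
    ∑' m : ℕ, (if (m : ℝ) ≤ X then ENNReal.ofReal ((max 1 (m : ℝ)) ^ (a - 1)) else 0)
      ≤ ENNReal.ofReal ((1 + 1 / a) * X ^ a) := by
  have hX0 : 0 ≤ X := by linarith
  rw [tsum_eq_sum (s := Finset.range (⌊X⌋₊ + 1))]
  · refine (Finset.sum_le_sum (g := fun m : ℕ => ENNReal.ofReal ((max 1 (m : ℝ)) ^ (a - 1)))
      fun m _ => by split_ifs <;> simp).trans ?_
    rw [← ENNReal.ofReal_sum_of_nonneg fun _ _ => by positivity]
    refine ENNReal.ofReal_le_ofReal ((sum_range_max_rpow_le ha ha1 _).trans ?_)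
    have h1 : (⌊X⌋₊ : ℝ) ^ a ≤ X ^ a :=
      Real.rpow_le_rpow (by positivity) (Nat.floor_le hX0) ha.le
    have h2 : 1 ≤ X ^ a := Real.one_le_rpow hX ha.le
    rw [add_mul, one_mul, one_div_mul_eq_div]
    gcongr
  · intro m hm
    rw [if_neg]
    intro h
    exact hm (Finset.mem_range.2 (Nat.lt_succ_of_le (Nat.le_floor h)))

lemma tsum_max_rpow_ne_top {p : ℝ} (hp : 1 < p) :
    ∑' m : ℕ, ENNReal.ofReal ((max 1 (m : ℝ)) ^ (-p)) ≠ ∞ := by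
  have hs : Summable fun m : ℕ => (max 1 (m : ℝ)) ^ (-p) := by
    rw [← summable_nat_add_iff 1]
    refine ((summable_nat_add_iff 1).2 (Real.summable_nat_rpow.2 (neg_lt_neg hp))).congr fun m => ?_
    have : max 1 ((m + 1 : ℕ) : ℝ) = ((m + 1 : ℕ) : ℝ) := by push_cast; simp
    rw [this]
  exact hs.tsum_ofReal_ne_top

lemma tsum_natAbs_le (F : ℕ → ℝ≥0∞) : ∑' j : ℤ, F j.natAbs ≤ 2 * ∑' m, F m := by
  rw [tsum_of_nat_of_neg_add_one ENNReal.summable ENNReal.summable, two_mul]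
  refine add_le_add (by simp) ?_
  refine le_trans (le_of_eq ?_) (ENNReal.tsum_comp_le_tsum_of_injective Nat.succ_injective F)
  refine tsum_congr fun m => ?_
  congr 1

lemma tsum_prod_coord_le (F : ℤ → ℝ≥0∞) :
    ∑' n : Fin 3 → ℤ, F (n 0) * F (n 1) * F (n 2) ≤ (∑' j, F j) ^ 3 := by
  have hinj : Function.Injective fun n : Fin 3 → ℤ => (n 0, n 1, n 2) := by
    intro n m h
    simp only [Prod.mk.injEq] at h
    ext i
    fin_cases i
    exacts [h.1, h.2.1, h.2.2]
  refine (ENNReal.tsum_comp_le_tsum_of_injective hinj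
    fun q : ℤ × ℤ × ℤ => F q.1 * F q.2.1 * F q.2.2).trans (le_of_eq ?_)
  simp_rw [ENNReal.tsum_prod', mul_assoc, ENNReal.tsum_mul_left, ENNReal.tsum_mul_right]
  ring

open Classical in
/-- A lattice sum of powers of `|ň|` is controlled by the cube of a one-dimensional sum. -/
lemma tsum_cnorm_rpow_le {L₁ L₂ c q : ℝ} (hc : 0 < c) (hq : 0 ≤ q)
    (hbd : ∀ n : Fin 3 → ℤ, n ≠ 0 → ∀ i, c * max 1 ((n i).natAbs : ℝ) ≤ cnorm L₁ L₂ n)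
    (P : (Fin 3 → ℤ) → Prop) (F : ℕ → ℝ≥0∞)
    (hF : ∀ n, n ≠ 0 → P n → ∀ i,
      ENNReal.ofReal ((max 1 ((n i).natAbs : ℝ)) ^ (-q)) ≤ F (n i).natAbs) :
    ∑' n, (if n ≠ 0 ∧ P n then ENNReal.ofReal (cnorm L₁ L₂ n ^ (-(3 * q))) else 0)
      ≤ ENNReal.ofReal (c ^ (-(3 * q))) * (2 * ∑' m, F m) ^ 3 := by
  calc _ ≤ ∑' n : Fin 3 → ℤ, ENNReal.ofReal (c ^ (-(3 * q))) *
        (F (n 0).natAbs * F (n 1).natAbs * F (n 2).natAbs) := by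
        refine ENNReal.tsum_le_tsum fun n => ?_
        split_ifs with h
        · obtain ⟨hn, hP⟩ := h
          refine le_trans ?_ (mul_le_mul_right (mul_le_mul' (mul_le_mul' (hF n hn hP 0)
            (hF n hn hP 1)) (hF n hn hP 2)) _)
          rw [← ENNReal.ofReal_mul (by positivity), ← ENNReal.ofReal_mul (by positivity),
            ← ENNReal.ofReal_mul (by positivity)]
          refine ENNReal.ofReal_le_ofReal ?_
          have key : ∀ i, cnorm L₁ L₂ n ^ (-q) ≤ c ^ (-q) * (max 1 ((n i).natAbs : ℝ)) ^ (-q) := by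
            intro i
            rw [← Real.mul_rpow hc.le (by positivity)]
            exact Real.rpow_le_rpow_of_nonpos (by positivity) (hbd n hn i) (by linarith)
          have hcube : ∀ x : ℝ, 0 ≤ x → x ^ (-(3 * q)) = x ^ (-q) * x ^ (-q) * x ^ (-q) := by
            intro x hx
            rw [show -(3 * q) = -q * (3 : ℕ) by push_cast; ring, Real.rpow_mul_natCast hx]
            ring
          rw [hcube _ (cnorm_nonneg _ _ _), hcube _ hc.le]
          have hx := Real.rpow_nonneg (cnorm_nonneg L₁ L₂ n) (-q)
          calc _ ≤ _ := mul_le_mul (mul_le_mul (key 0) (key 1) hx (by positivity)) (key 2) hx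
                (by positivity)
            _ = _ := by ring
        · exact zero_le
    _ ≤ _ := by
        rw [ENNReal.tsum_mul_left]
        gcongr
        exact (tsum_prod_coord_le fun j => F j.natAbs).trans (by gcongr; exact tsum_natAbs_le F)

lemma ENNReal.tsum_mul_le_sqrt_mul_sqrt {ι : Type*} (u v : ι → ℝ≥0∞) :
    ∑' i, u i * v i ≤ (∑' i, u i ^ 2) ^ (1 / 2 : ℝ) * (∑' i, v i ^ 2) ^ (1 / 2 : ℝ) := by
  rw [ENNReal.tsum_eq_iSup_sum]
  refine iSup_le fun s => ?_
  have := ENNReal.inner_le_Lp_mul_Lq s u v Real.HolderConjugate.two_two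
  simp only [ENNReal.rpow_two] at this
  exact this.trans (by gcongr <;> exact ENNReal.sum_le_tsum s)

lemma ehnorm_eq (L₁ L₂ s : ℝ) (u : (Fin 3 → ℤ) → ℂ) :
    ehnorm L₁ L₂ s u =
      (∑' n, ENNReal.ofReal (cnorm L₁ L₂ n ^ s * ‖u n‖) ^ 2) ^ (1 / 2 : ℝ) := by
  unfold ehnorm
  congr 1
  refine tsum_congr fun n => ?_
  have h := Real.rpow_nonneg (cnorm_nonneg L₁ L₂ n) s
  rw [← ENNReal.ofReal_pow (by positivity), mul_pow, mul_comm 2 s, ← Nat.cast_two,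
    Real.rpow_mul_natCast (cnorm_nonneg _ _ _)]

open Classical in
/-- Trilinear bound on the part of the convolution sum where `P` holds, by Cauchy–Schwarz in both
frequencies. -/
lemma tsum_ite_trilinear_le {L₁ L₂ s t K : ℝ}
    (hpos : ∀ n : Fin 3 → ℤ, n ≠ 0 → 0 < cnorm L₁ L₂ n)
    (P : (Fin 3 → ℤ) → (Fin 3 → ℤ) → Prop)
    (hK : ∀ k, k ≠ 0 →
      ∑' n, (if n ≠ 0 ∧ P n k then ENNReal.ofReal (cnorm L₁ L₂ n ^ (-(2 * s))) else 0)
        ≤ ENNReal.ofReal K * ENNReal.ofReal (cnorm L₁ L₂ k ^ (2 * t)))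
    (f g h : (Fin 3 → ℤ) → ℂ) (hf : f 0 = 0) (hg : g 0 = 0) :
    ∑' p : (Fin 3 → ℤ) × (Fin 3 → ℤ),
      (if P p.1 p.2 then ENNReal.ofReal (‖f p.1‖ * ‖g p.2‖ * ‖h (-p.1 - p.2)‖) else 0)
      ≤ ENNReal.ofReal K ^ (1 / 2 : ℝ) * ehnorm L₁ L₂ s f * ehnorm L₁ L₂ t g *
          ehnorm L₁ L₂ 0 h := by
  set A : (Fin 3 → ℤ) → ℝ≥0∞ := fun n => ENNReal.ofReal (cnorm L₁ L₂ n ^ s * ‖f n‖) with hA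
  set B : (Fin 3 → ℤ) → ℝ≥0∞ := fun n => ENNReal.ofReal (cnorm L₁ L₂ n ^ t * ‖g n‖) with hB
  set H : (Fin 3 → ℤ) → ℝ≥0∞ := fun n => ENNReal.ofReal (cnorm L₁ L₂ n ^ (0 : ℝ) * ‖h n‖) with hH
  set u : (Fin 3 → ℤ) → (Fin 3 → ℤ) → ℝ≥0∞ := fun n k =>
    if n ≠ 0 ∧ P n k then ENNReal.ofReal (cnorm L₁ L₂ n ^ (-s)) else 0 with hu
  set Y : (Fin 3 → ℤ) → ℝ≥0∞ := fun k => ENNReal.ofReal (cnorm L₁ L₂ k ^ (-t)) with hY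
  have hterm : ∀ p : (Fin 3 → ℤ) × (Fin 3 → ℤ),
      (if P p.1 p.2 then ENNReal.ofReal (‖f p.1‖ * ‖g p.2‖ * ‖h (-p.1 - p.2)‖) else 0)
        ≤ (A p.1 * H (-p.1 - p.2)) * (B p.2 * Y p.2 * u p.1 p.2) := by
    rintro ⟨n, k⟩
    by_cases hP : P n k
    swap
    · simp [hP]
    by_cases hn : n = 0
    · simp [hn, hf]
    by_cases hk : k = 0
    · simp [hk, hg]
    have hn' := hpos n hn
    have hk' := hpos k hk
    simp only [hA, hB, hH, hu, hY, hP, hn, if_true, ne_eq, not_false_eq_true, and_self,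
      Real.rpow_zero, one_mul]
    rw [← ENNReal.ofReal_mul (by positivity), ← ENNReal.ofReal_mul (by positivity),
      ← ENNReal.ofReal_mul (by positivity), ← ENNReal.ofReal_mul (by positivity)]
    refine le_of_eq (congrArg _ ?_)
    rw [Real.rpow_neg hn'.le, Real.rpow_neg hk'.le]
    have := (Real.rpow_pos_of_pos hn' s).ne'
    have := (Real.rpow_pos_of_pos hk' t).ne'
    field_simp
  have hfirst : ∑' p : (Fin 3 → ℤ) × (Fin 3 → ℤ), (A p.1 * H (-p.1 - p.2)) ^ 2
      = (∑' n, A n ^ 2) * ∑' n, H n ^ 2 := by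
    simp_rw [ENNReal.tsum_prod', mul_pow, ENNReal.tsum_mul_left]
    rw [← ENNReal.tsum_mul_right]
    refine tsum_congr fun n => ?_
    congr 1
    exact (Equiv.subLeft (-n)).tsum_eq fun k => H k ^ 2
  have husq : ∀ n k, u n k ^ 2 =
      if n ≠ 0 ∧ P n k then ENNReal.ofReal (cnorm L₁ L₂ n ^ (-(2 * s))) else 0 := by
    intro n k
    simp only [hu]
    split_ifs
    · rw [← ENNReal.ofReal_pow (Real.rpow_nonneg (cnorm_nonneg _ _ _) _),
        ← Real.rpow_mul_natCast (cnorm_nonneg _ _ _)]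
      congr 2
      push_cast
      ring
    · simp
  have hsecond : ∑' p : (Fin 3 → ℤ) × (Fin 3 → ℤ), (B p.2 * Y p.2 * u p.1 p.2) ^ 2
      ≤ ENNReal.ofReal K * ∑' k, B k ^ 2 := by
    rw [ENNReal.tsum_prod', ENNReal.tsum_comm]
    simp_rw [mul_pow, ENNReal.tsum_mul_left, husq]
    rw [← ENNReal.tsum_mul_left]
    refine ENNReal.tsum_le_tsum fun k => ?_
    by_cases hk : k = 0
    · simp [hk, hB, hg]
    refine (mul_le_mul_right (hK k hk) _).trans (le_of_eq ?_)
    have hk' := hpos k hk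
    have hYk : Y k ^ 2 * ENNReal.ofReal (cnorm L₁ L₂ k ^ (2 * t)) = 1 := by
      simp only [hY]
      rw [← ENNReal.ofReal_pow (by positivity), ← Real.rpow_mul_natCast hk'.le,
        ← ENNReal.ofReal_mul (by positivity), ← Real.rpow_add hk']
      push_cast
      rw [show -t * 2 + 2 * t = 0 by ring, Real.rpow_zero, ENNReal.ofReal_one]
    calc _ = ENNReal.ofReal K * B k ^ 2 * (Y k ^ 2 * ENNReal.ofReal (cnorm L₁ L₂ k ^ (2 * t))) := by
          ring
      _ = _ := by rw [hYk, mul_one]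
  calc _ ≤ _ := ENNReal.tsum_le_tsum hterm
    _ ≤ _ := ENNReal.tsum_mul_le_sqrt_mul_sqrt _ _
    _ ≤ ((∑' n, A n ^ 2) * ∑' n, H n ^ 2) ^ (1 / 2 : ℝ) *
        (ENNReal.ofReal K * ∑' k, B k ^ 2) ^ (1 / 2 : ℝ) := by
        rw [hfirst]
        gcongr
    _ = _ := by
        rw [ENNReal.mul_rpow_of_nonneg _ _ (by norm_num),
          ENNReal.mul_rpow_of_nonneg _ _ (by norm_num), ehnorm_eq, ehnorm_eq, ehnorm_eq]
        ring

open Classical in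
/-- Trilinear bound on the part of the convolution sum where the first frequency is smaller. -/
lemma exists_tsum_ite_cnorm_le_trilinear_le {L₁ L₂ : ℝ} (hL₁ : 0 < L₁) (hL₂ : 0 < L₂)
    {β : ℝ} (hβ : 0 < β) (hβ' : β < 3 / 2) :
    ∃ C : ℝ, 0 ≤ C ∧ ∀ f g h : (Fin 3 → ℤ) → ℂ, f 0 = 0 → g 0 = 0 →
      ∑' p : (Fin 3 → ℤ) × (Fin 3 → ℤ), (if cnorm L₁ L₂ p.1 ≤ cnorm L₁ L₂ p.2 then
        ENNReal.ofReal (‖f p.1‖ * ‖g p.2‖ * ‖h (-p.1 - p.2)‖) else 0)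
      ≤ ENNReal.ofReal C * ehnorm L₁ L₂ (3 / 2 - β) f * ehnorm L₁ L₂ β g *
          ehnorm L₁ L₂ 0 h := by
  obtain ⟨c, hc, hbd⟩ := exists_mul_max_le_cnorm hL₁ hL₂
  have hlow : ∀ n : Fin 3 → ℤ, n ≠ 0 → c ≤ cnorm L₁ L₂ n := fun n hn =>
    (le_mul_of_one_le_right hc.le (le_max_left _ _)).trans (hbd n hn 0)
  set a : ℝ := 2 * β / 3 with ha
  have ha0 : 0 < a := by positivity
  have ha1 : a ≤ 1 := by linarith
  set K : ℝ := c ^ (-(3 * (1 - a))) * (2 * ((1 + 1 / a) * (c⁻¹) ^ a)) ^ 3 with hKdef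
  have hK0 : 0 ≤ K := by positivity
  refine ⟨K ^ (1 / 2 : ℝ), by positivity, fun f g h hf hg => ?_⟩
  rw [← ENNReal.ofReal_rpow_of_nonneg hK0 (by norm_num)]
  refine tsum_ite_trilinear_le (fun n hn => hc.trans_le (hlow n hn))
    (fun n k => cnorm L₁ L₂ n ≤ cnorm L₁ L₂ k) (fun k hk => ?_) f g h hf hg
  have hk0 : 0 < cnorm L₁ L₂ k := hc.trans_le (hlow k hk)
  have hX : 1 ≤ cnorm L₁ L₂ k * c⁻¹ := by
    rw [← div_eq_mul_inv, one_le_div hc]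
    exact hlow k hk
  have hsum := tsum_cnorm_rpow_le hc (by linarith : 0 ≤ 1 - a) hbd
    (fun n => cnorm L₁ L₂ n ≤ cnorm L₁ L₂ k)
    (fun m => if (m : ℝ) ≤ cnorm L₁ L₂ k * c⁻¹ then
      ENNReal.ofReal ((max 1 (m : ℝ)) ^ (a - 1)) else 0)
    (fun n hn hP i => by
      rw [if_pos, neg_sub]
      rw [← div_eq_mul_inv, le_div_iff₀ hc, mul_comm]
      exact (mul_le_mul_of_nonneg_left (le_max_right _ _) hc.le).trans ((hbd n hn i).trans hP))
  rw [show 2 * (3 / 2 - β) = 3 * (1 - a) by rw [ha]; ring]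
  refine hsum.trans ((mul_le_mul_right (pow_le_pow_left' (mul_le_mul_right
    (tsum_ite_le_max_rpow_le ha0 ha1 hX) 2) 3) _).trans (le_of_eq ?_))
  rw [← ENNReal.ofReal_ofNat 2, ← ENNReal.ofReal_mul (by norm_num),
    ← ENNReal.ofReal_pow (by positivity), ← ENNReal.ofReal_mul (by positivity),
    ← ENNReal.ofReal_mul hK0]
  congr 1
  rw [hKdef, Real.mul_rpow hk0.le (by positivity), show 2 * β = a * (3 : ℕ) by
    rw [ha]; push_cast; ring, Real.rpow_mul_natCast hk0.le]
  ring

lemma convSum_le (G : Set ((Fin 3 → ℤ) × (Fin 3 → ℤ) × (Fin 3 → ℤ))) (f g h : (Fin 3 → ℤ) → ℂ) :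
    convSum G f g h ≤ ∑' p : (Fin 3 → ℤ) × (Fin 3 → ℤ),
      ENNReal.ofReal (‖f p.1‖ * ‖g p.2‖ * ‖h (-p.1 - p.2)‖) := by
  refine ENNReal.tsum_le_tsum fun p => ENNReal.ofReal_le_ofReal ?_
  refine mul_le_of_le_one_right (by positivity) ?_
  exact Set.indicator_le_self' (fun _ _ => zero_le_one) _

theorem stmt19 (L₁ L₂ : ℝ) (hL₁ : 0 < L₁) (hL₂ : 0 < L₂) :
    (∀ γ : ℝ, 0 < γ → ∃ C : ℝ,
      ∀ (G : Set ((Fin 3 → ℤ) × (Fin 3 → ℤ) × (Fin 3 → ℤ))),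
      (∀ p ∈ G, p.1 ≠ 0 ∧ p.2.1 ≠ 0 ∧ p.2.2 ≠ 0) →
      ∀ f g h : (Fin 3 → ℤ) → ℂ, f 0 = 0 → g 0 = 0 → h 0 = 0 →
      convSum G f g h
        ≤ ENNReal.ofReal C * ehnorm L₁ L₂ (3 / 2 + γ) f *
            ehnorm L₁ L₂ 0 g * ehnorm L₁ L₂ 0 h) ∧
    (∀ β : ℝ, 0 < β → β < 3 / 2 → ∃ C : ℝ,
      ∀ (G : Set ((Fin 3 → ℤ) × (Fin 3 → ℤ) × (Fin 3 → ℤ))),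
      (∀ p ∈ G, p.1 ≠ 0 ∧ p.2.1 ≠ 0 ∧ p.2.2 ≠ 0) →
      ∀ f g h : (Fin 3 → ℤ) → ℂ, f 0 = 0 → g 0 = 0 → h 0 = 0 →
      convSum G f g h
        ≤ ENNReal.ofReal C * ehnorm L₁ L₂ (3 / 2 - β) f *
            ehnorm L₁ L₂ β g * ehnorm L₁ L₂ 0 h) := by
  classical
  refine ⟨fun γ hγ => ?_, fun β hβ hβ' => ?_⟩
  · obtain ⟨c, hc, hbd⟩ := exists_mul_max_le_cnorm hL₁ hL₂
    have hpos : ∀ n : Fin 3 → ℤ, n ≠ 0 → 0 < cnorm L₁ L₂ n := fun n hn =>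
      lt_of_lt_of_le (by positivity) (hbd n hn 0)
    set q : ℝ := 1 + 2 * γ / 3 with hq
    have hq1 : 1 < q := by rw [hq]; linarith
    have hsum := tsum_cnorm_rpow_le hc (by linarith : 0 ≤ q) hbd (fun _ => True)
      (fun m => ENNReal.ofReal ((max 1 (m : ℝ)) ^ (-q))) (fun _ _ _ _ => le_rfl)
    set S := ENNReal.ofReal (c ^ (-(3 * q))) *
      (2 * ∑' m : ℕ, ENNReal.ofReal ((max 1 (m : ℝ)) ^ (-q))) ^ 3 with hS
    have hStop : S ≠ ∞ := ENNReal.mul_ne_top ENNReal.ofReal_ne_top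
      (ENNReal.pow_ne_top (ENNReal.mul_ne_top (by norm_num) (tsum_max_rpow_ne_top hq1)))
    refine ⟨S.toReal ^ (1 / 2 : ℝ), fun G _ f g h hf hg _ => (convSum_le G f g h).trans ?_⟩
    rw [← ENNReal.ofReal_rpow_of_nonneg ENNReal.toReal_nonneg (by norm_num)]
    have := tsum_ite_trilinear_le (s := 3 / 2 + γ) (t := 0) (K := S.toReal) hpos
      (fun _ _ => True) (fun k _ => by
        rw [show 2 * (3 / 2 + γ) = 3 * q by rw [hq]; ring, ENNReal.ofReal_toReal hStop]
        simpa using hsum) f g h hf hg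
    simpa using this
  · obtain ⟨C₁, hC₁, h₁⟩ := exists_tsum_ite_cnorm_le_trilinear_le hL₁ hL₂ hβ hβ'
    obtain ⟨C₂, hC₂, h₂⟩ := exists_tsum_ite_cnorm_le_trilinear_le hL₁ hL₂
      (β := 3 / 2 - β) (by linarith) (by linarith)
    refine ⟨C₁ + C₂, fun G _ f g h hf hg _ => (convSum_le G f g h).trans ?_⟩
    have hswap : ∑' p : (Fin 3 → ℤ) × (Fin 3 → ℤ), (if cnorm L₁ L₂ p.2 ≤ cnorm L₁ L₂ p.1 then
        ENNReal.ofReal (‖f p.1‖ * ‖g p.2‖ * ‖h (-p.1 - p.2)‖) else 0)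
        ≤ ENNReal.ofReal C₂ * ehnorm L₁ L₂ β g * ehnorm L₁ L₂ (3 / 2 - β) f *
          ehnorm L₁ L₂ 0 h := by
      have hgf := h₂ g f h hg hf
      rw [sub_sub_cancel] at hgf
      rw [← (Equiv.prodComm _ _).tsum_eq]
      refine (tsum_congr fun p => if_congr Iff.rfl (congrArg _ ?_) rfl).le.trans hgf
      change ‖f p.2‖ * ‖g p.1‖ * ‖h (-p.2 - p.1)‖ = ‖g p.1‖ * ‖f p.2‖ * ‖h (-p.1 - p.2)‖
      rw [mul_comm ‖f p.2‖, neg_sub_comm]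
    calc _ ≤ _ := ENNReal.tsum_le_tsum fun p => ?_
      _ ≤ _ := (ENNReal.tsum_add).le.trans (add_le_add (h₁ f g h hf hg) hswap)
      _ = _ := by
        rw [ENNReal.ofReal_add hC₁ hC₂]
        ring
    rcases le_total (cnorm L₁ L₂ p.1) (cnorm L₁ L₂ p.2) with hle | hle
    · rw [if_pos hle]
      exact le_self_add
    · rw [if_pos hle]
      exact le_add_self
end
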